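/- arXiv:2311.10772 — 3 statements merged into one kernel-verified Lean document; each statement's English description precedes it below -/
import Mathlib

section
/- The points P and Q are isogonal conjugates in triangle ABC (i.e. the directed angles modulo π satisfy ∡(AP,AB) = ∡(AC,AQ), ∡(BP,BC) = ∡(BA,BQ), ∡(CP,CA) = ∡(CB,CQ)), and the following directed angles modulo π are equal: ∡PA₁A₂ = ∡PB₁B₂ = ∡PC₁C₂ = −∡QA₂A₁ = −∡QB₂B₁ = −∡QC₂C₁. -/
open EuclideanGeometry

noncomputable local instance : Module.Oriented ℝ ℂ (Fin 2) := ⟨Complex.orientation⟩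
local instance : Fact (Module.finrank ℝ ℂ = 2) := ⟨Complex.finrank_real_complex⟩

open scoped ComplexConjugate

/-- The doubled oriented angle between complex vectors, as an algebraic condition. -/
lemma two_zsmul_arg_eq_iff {z w : ℂ} (hz : z ≠ 0) (hw : w ≠ 0) :
    (2 : ℤ) • (z.arg : Real.Angle) = (2 : ℤ) • (w.arg : Real.Angle) ↔ (z * conj w).im = 0 := by
  have hw' : conj w ≠ 0 := by simpa using hw
  have h : (z.arg : Real.Angle) - w.arg = ((z * conj w).arg : Real.Angle) := by
    rw [Complex.arg_mul_coe_angle hz hw', Complex.arg_conj_coe_angle, sub_eq_add_neg]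
  rw [← sub_eq_zero, ← smul_sub, h, Real.Angle.two_zsmul_eq_zero_iff, ← Real.Angle.sin_eq_zero_iff,
    Real.Angle.sin_coe, Complex.sin_arg, div_eq_zero_iff, norm_eq_zero]
  simp [hz, hw]

lemma two_zsmul_oangle_eq_iff {X Y Z U V W : ℂ} (hX : X ≠ Y) (hZ : Z ≠ Y) (hU : U ≠ V)
    (hW : W ≠ V) : (2 : ℤ) • ∡ X Y Z = (2 : ℤ) • ∡ U V W ↔
      (conj (X - Y) * (Z - Y) * conj (conj (U - V) * (W - V))).im = 0 := by
  have hne {p q : ℂ} (h : p ≠ q) : conj (p - q) ≠ 0 :=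
    (map_ne_zero _).2 (sub_ne_zero.2 h)
  rw [← two_zsmul_arg_eq_iff (mul_ne_zero (hne hX) (sub_ne_zero.2 hZ))
    (mul_ne_zero (hne hU) (sub_ne_zero.2 hW)), ← Complex.oangle, ← Complex.oangle]
  rfl

lemma im_mul_eq_zero_of_sums {f₁ f₂ f₃ g₁ g₂ g₃ : ℂ}
    (hf₂ : (f₁ * conj f₂).im = 0) (hf₃ : (f₁ * conj f₃).im = 0)
    (hg₂ : (g₁ * conj g₂).im = 0) (hg₃ : (g₁ * conj g₃).im = 0)
    (him : (f₁ + f₂ + f₃).im = (g₁ + g₂ + g₃).im) (hne : (f₁ + f₂ + f₃).im ≠ 0)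
    (hre : (f₁ + f₂ + f₃).re + (g₁ + g₂ + g₃).re = 0) : (f₁ * g₁).im = 0 := by
  simp only [Complex.add_re, Complex.add_im, Complex.mul_im, Complex.conj_re,
    Complex.conj_im] at *
  refine (mul_eq_zero.1 (?_ : (f₁.im + f₂.im + f₃.im) *
    (f₁.re * g₁.im + f₁.im * g₁.re) = 0)).resolve_left hne
  linear_combination (-g₁.im) * (hf₂ + hf₃) - f₁.im * (hg₂ + hg₃) +
    f₁.im * g₁.re * him + f₁.im * g₁.im * hre

/-- The chord `XY` of a circle centred at `O` has its midpoint at the foot of the perpendicular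
from `O`. -/
lemma re_conj_mul_direction_eq_zero {O X Y D : ℂ} {k : ℝ} (hXY : X ≠ Y) (hD : Y - X = k * D)
    (hd : dist X O = dist Y O) : (conj (X + Y - 2 * O) * D).re = 0 := by
  have hk : k ≠ 0 := by
    rintro rfl
    exact hXY (by linear_combination -hD - (by simp : ((0 : ℝ) : ℂ) * D = 0))
  have hd' : Complex.normSq (X - O) = Complex.normSq (Y - O) := by
    rw [Complex.normSq_eq_norm_sq, Complex.normSq_eq_norm_sq, ← dist_eq_norm, ← dist_eq_norm, hd]
  have hr := congrArg Complex.re hD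
  have hi := congrArg Complex.im hD
  simp only [Complex.normSq_apply, Complex.sub_re, Complex.sub_im, Complex.add_re, Complex.add_im,
    Complex.mul_re, Complex.mul_im, Complex.conj_re, Complex.conj_im, Complex.ofReal_re,
    Complex.ofReal_im, Complex.re_ofNat, Complex.im_ofNat] at *
  refine (mul_eq_zero.1 (?_ : k * _ = 0)).resolve_left hk
  linear_combination -hd' - (X.re + Y.re - 2 * O.re) * hr - (X.im + Y.im - 2 * O.im) * hi

lemma exists_real_direction {X Y B C : ℂ} (hX : X ∈ line[ℝ, B, C]) (hY : Y ∈ line[ℝ, B, C]) :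
    ∃ k : ℝ, Y - X = k * (C - B) := by
  have h := AffineSubspace.vsub_mem_direction hY hX
  rw [direction_affineSpan, mem_vectorSpan_pair_rev] at h
  obtain ⟨k, hk⟩ := h
  exact ⟨k, by simpa using hk.symm⟩

lemma im_conj_mul_direction {X B C : ℂ} (hX : X ∈ line[ℝ, B, C]) :
    (conj X * (C - B)).im = (conj B * (C - B)).im := by
  obtain ⟨k, hk⟩ := exists_real_direction (left_mem_affineSpan_pair ℝ B C) hX
  obtain rfl : X = B + k * (C - B) := by linear_combination hk
  simp
  ring

lemma area_ne_zero {A B C : ℂ} (h : AffineIndependent ℝ ![A, B, C]) :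
    (conj B * (C - B) + conj C * (A - C) + conj A * (B - A)).im ≠ 0 := by
  intro h0
  rw [affineIndependent_iff_not_collinear_set] at h
  apply h
  by_cases hBA : B = A
  · subst hBA
    simpa using collinear_pair ℝ B C
  rw [collinear_iff_of_mem (p₀ := A) (by simp)]
  refine ⟨B - A, ?_⟩
  have hn : Complex.normSq (B - A) ≠ 0 := by simpa [sub_eq_zero] using hBA
  have hC : C = ((conj (B - A) * (C - A)).re / Complex.normSq (B - A)) • (B - A) +ᵥ A := by
    have hr := div_mul_cancel₀ (conj (B - A) * (C - A)).re hn
    generalize (conj (B - A) * (C - A)).re / Complex.normSq (B - A) = r at hr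
    simp only [Complex.normSq_apply] at hn hr
    apply Complex.ext <;> refine mul_right_cancel₀ hn ?_ <;>
    simp only [Complex.real_smul, vadd_eq_add, Complex.sub_re,
      Complex.sub_im, Complex.add_re, Complex.add_im, Complex.mul_re, Complex.mul_im,
      Complex.conj_re, Complex.conj_im, Complex.ofReal_re, Complex.ofReal_im, map_sub] at *
    · linear_combination (A.im - B.im) * h0 - (B.re - A.re) * hr
    · linear_combination (B.re - A.re) * h0 - (B.im - A.im) * hr
  intro p hp
  simp only [Set.mem_insert_iff, Set.mem_singleton_iff] at hp
  rcases hp with rfl | rfl | rfl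
  · exact ⟨0, by simp⟩
  · exact ⟨1, by simp⟩
  · exact ⟨_, hC⟩

/-- The key step: at one side of the triangle, the two constant angles of a pair of Miquel
configurations inscribed in a common circle are opposite. -/
lemma two_zsmul_oangle_miquel_eq {A B C O P Q A₁ A₂ B₁ B₂ C₁ C₂ : ℂ}
    (hABC : AffineIndependent ℝ ![A, B, C])
    (hA₁ : A₁ ∈ line[ℝ, B, C]) (hA₂ : A₂ ∈ line[ℝ, B, C])
    (hB₁ : B₁ ∈ line[ℝ, C, A]) (hB₂ : B₂ ∈ line[ℝ, C, A])
    (hC₁ : C₁ ∈ line[ℝ, A, B]) (hC₂ : C₂ ∈ line[ℝ, A, B])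
    (hA : A₁ ≠ A₂) (hB : B₁ ≠ B₂) (hC : C₁ ≠ C₂)
    (hdA : dist A₁ O = dist A₂ O) (hdB : dist B₁ O = dist B₂ O) (hdC : dist C₁ O = dist C₂ O)
    (hPA : P ≠ A₁) (hPB : P ≠ B₁) (hPC : P ≠ C₁) (hQA : Q ≠ A₂) (hQB : Q ≠ B₂) (hQC : Q ≠ C₂)
    (hPAB : (2 : ℤ) • ∡ P A₁ A₂ = (2 : ℤ) • ∡ P B₁ B₂)
    (hPAC : (2 : ℤ) • ∡ P A₁ A₂ = (2 : ℤ) • ∡ P C₁ C₂)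
    (hQAB : (2 : ℤ) • ∡ Q A₂ A₁ = (2 : ℤ) • ∡ Q B₂ B₁)
    (hQAC : (2 : ℤ) • ∡ Q A₂ A₁ = (2 : ℤ) • ∡ Q C₂ C₁) :
    (2 : ℤ) • ∡ P A₁ A₂ = (2 : ℤ) • ∡ A₁ A₂ Q := by
  rw [two_zsmul_oangle_eq_iff hPA hA.symm hPB hB.symm] at hPAB
  rw [two_zsmul_oangle_eq_iff hPA hA.symm hPC hC.symm] at hPAC
  rw [two_zsmul_oangle_eq_iff hQA hA hQB hB] at hQAB
  rw [two_zsmul_oangle_eq_iff hQA hA hQC hC] at hQAC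
  rw [two_zsmul_oangle_eq_iff hPA hA.symm hA hQA]
  obtain ⟨a, ha⟩ := exists_real_direction hA₁ hA₂
  obtain ⟨b, hb⟩ := exists_real_direction hB₁ hB₂
  obtain ⟨c, hc⟩ := exists_real_direction hC₁ hC₂
  have ne_zero {X Y D : ℂ} {k : ℝ} (hXY : X ≠ Y) (h : Y - X = k * D) : k ≠ 0 := by
    rintro rfl
    exact hXY (by linear_combination -h - (by simp : ((0 : ℝ) : ℂ) * D = 0))
  have scale {k l : ℝ} (hk : k ≠ 0) (hl : l ≠ 0) {z w : ℂ}
      (h : (k * z * conj (l * w)).im = 0) : (z * conj w).im = 0 := by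
    have e : k * z * conj (l * w) = ((k * l : ℝ) : ℂ) * (z * conj w) := by
      simp only [map_mul, Complex.conj_ofReal]
      push_cast
      ring
    rw [e, Complex.im_ofReal_mul] at h
    exact (mul_eq_zero.1 h).resolve_left (mul_ne_zero hk hl)
  have ha₀ := ne_zero hA ha
  have hb₀ := ne_zero hB hb
  have hc₀ := ne_zero hC hc
  have swap {X Y D : ℂ} {k : ℝ} (h : Y - X = k * D) : X - Y = (-k : ℝ) * D := by
    push_cast
    linear_combination -h
  have ma := re_conj_mul_direction_eq_zero hA ha hdA
  have mb := re_conj_mul_direction_eq_zero hB hb hdB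
  have mc := re_conj_mul_direction_eq_zero hC hc hdC
  have harea := area_ne_zero hABC
  have key : ((conj (P - A₁) * (C - B)) * (conj (Q - A₂) * (C - B))).im = 0 := by
    have ia := im_conj_mul_direction hA₁
    have ia' := im_conj_mul_direction hA₂
    have ib := im_conj_mul_direction hB₁
    have ib' := im_conj_mul_direction hB₂
    have ic := im_conj_mul_direction hC₁
    have ic' := im_conj_mul_direction hC₂
    refine im_mul_eq_zero_of_sums
      (f₂ := conj (P - B₁) * (A - C)) (f₃ := conj (P - C₁) * (B - A))
      (g₂ := conj (Q - B₂) * (A - C)) (g₃ := conj (Q - C₂) * (B - A))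
      (scale ha₀ hb₀ ?_) (scale ha₀ hc₀ ?_)
      (scale (neg_ne_zero.2 ha₀) (neg_ne_zero.2 hb₀) ?_)
      (scale (neg_ne_zero.2 ha₀) (neg_ne_zero.2 hc₀) ?_) ?_ ?_ ?_
    · rwa [mul_left_comm, ← ha, mul_left_comm (b : ℂ), ← hb]
    · rwa [mul_left_comm, ← ha, mul_left_comm (c : ℂ), ← hc]
    · rwa [mul_left_comm, ← swap ha, mul_left_comm ((-b : ℝ) : ℂ), ← swap hb]
    · rwa [mul_left_comm, ← swap ha, mul_left_comm ((-c : ℝ) : ℂ), ← swap hc]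
    · clear * - ia ia' ib ib' ic ic'
      simp only [Complex.sub_re, Complex.sub_im, Complex.add_im,
        Complex.mul_im, Complex.conj_re, Complex.conj_im, map_sub] at *
      linear_combination ia' - ia + ib' - ib + ic' - ic
    · contrapose! harea
      clear * - ia ib ic harea
      simp only [Complex.sub_re, Complex.sub_im, Complex.add_im,
        Complex.mul_im, Complex.conj_re, Complex.conj_im, map_sub] at *
      linear_combination -harea - ia - ib - ic
    · clear * - ma mb mc
      simp only [Complex.sub_re, Complex.sub_im, Complex.add_re, Complex.add_im, Complex.mul_re,
        Complex.mul_im, Complex.conj_re, Complex.conj_im, map_sub, Complex.re_ofNat,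
        Complex.im_ofNat] at *
      linear_combination -ma - mb - mc
  have e : conj (P - A₁) * (A₂ - A₁) * conj (conj (A₁ - A₂) * (Q - A₂)) =
      ((-(a * a) : ℝ) : ℂ) * ((conj (P - A₁) * (C - B)) * (conj (Q - A₂) * (C - B))) := by
    rw [map_mul, Complex.conj_conj, ha, swap ha]
    push_cast
    ring
  rw [e, Complex.im_ofReal_mul, key, mul_zero]

lemma two_zsmul_oangle_eq_of_cospherical_of_collinear {A P B₁ B₂ C₁ C₂ : ℂ}
    (h : Cospherical ({A, B₁, C₁, P} : Set ℂ)) (hB : Collinear ℝ {A, B₁, B₂})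
    (hC : Collinear ℝ {A, C₁, C₂}) (hAB₁ : A ≠ B₁) (hAC₁ : A ≠ C₁) (hB₁₂ : B₁ ≠ B₂)
    (hC₁₂ : C₁ ≠ C₂) (hPB₁ : P ≠ B₁) (hPC₁ : P ≠ C₁) :
    (2 : ℤ) • ∡ P B₁ B₂ = (2 : ℤ) • ∡ P C₁ C₂ := by
  have h' := h.two_zsmul_oangle_eq hAB₁.symm hPB₁.symm hAC₁.symm hPC₁.symm
  rw [hB.two_zsmul_oangle_eq_left hAB₁ hB₁₂.symm, hC.two_zsmul_oangle_eq_left hAC₁ hC₁₂.symm] at h'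
  rw [oangle_rev B₂, oangle_rev C₂, smul_neg, smul_neg, h']

/-- Isogonality at one vertex, from equality of the angles at two of the feet. -/
lemma two_zsmul_oangle_isogonal {A B C P Q B₁ B₂ C₁ C₂ : ℂ}
    (hP : Cospherical ({A, B₁, C₁, P} : Set ℂ)) (hQ : Cospherical ({A, B₂, C₂, Q} : Set ℂ))
    (hΓ : Cospherical ({B₂, B₁, C₂, C₁} : Set ℂ))
    (hC : Collinear ℝ {C, A, B₂}) (hB : Collinear ℝ {B, A, C₁})
    (hBA : B ≠ A) (hCA : C ≠ A) (hAB₂ : A ≠ B₂) (hAC₁ : A ≠ C₁)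
    (hB₁₂ : B₁ ≠ B₂) (hC₁₂ : C₁ ≠ C₂) (hB₁C₁ : B₁ ≠ C₁) (hB₂C₂ : B₂ ≠ C₂)
    (hPA : P ≠ A) (hPB₁ : P ≠ B₁) (hQA : Q ≠ A) (hQC₂ : Q ≠ C₂)
    (h : (2 : ℤ) • ∡ P B₁ B₂ = (2 : ℤ) • ∡ C₁ C₂ Q) :
    (2 : ℤ) • ∡ P A B = (2 : ℤ) • ∡ C A Q := by
  have hP' : Cospherical ({P, A, B₁, C₁} : Set ℂ) := by
    convert hP using 1
    grind
  have hQ' : Cospherical ({B₂, A, C₂, Q} : Set ℂ) := by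
    convert hQ using 1
    grind
  rw [hB.two_zsmul_oangle_eq_right hBA hAC₁.symm, hC.two_zsmul_oangle_eq_left hCA hAB₂.symm,
    hP'.two_zsmul_oangle_eq hPA.symm hAC₁ hPB₁.symm hB₁C₁,
    hQ'.two_zsmul_oangle_eq hAB₂ hQA.symm hB₂C₂.symm hQC₂.symm,
    ← oangle_add hPB₁ hB₁₂.symm hB₁C₁.symm, ← oangle_add hB₂C₂ hC₁₂ hQC₂, smul_add, smul_add, h,
    hΓ.two_zsmul_oangle_eq hB₁₂ hB₁C₁ hB₂C₂.symm hC₁₂.symm, add_comm]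

lemma ne_of_cospherical_of_collinear {A B C₁ A₁ P : ℂ}
    (h : Cospherical ({B, C₁, A₁, P} : Set ℂ)) (hcol : Collinear ℝ {A, B, C₁})
    (hAB : A ≠ B) (hAC₁ : A ≠ C₁) (hBC₁ : B ≠ C₁) : P ≠ A := by
  rintro rfl
  exact affineIndependent_iff_not_collinear_set.1
    (h.affineIndependent_of_mem_of_ne (by simp) (by simp) (by simp) hAB hAC₁ hBC₁) hcol

lemma ne_of_cospherical_of_mem_sphere {A A₁ B₁ C₁ C₂ P : ℂ} {Γ : Sphere ℂ}
    (h : Cospherical ({A, B₁, C₁, P} : Set ℂ)) (hA₁ : A₁ ∈ Γ) (hB₁ : B₁ ∈ Γ) (hC₁ : C₁ ∈ Γ)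
    (hC₂ : C₂ ∈ Γ) (hcol : Collinear ℝ {A, C₁, C₂}) (hAC₁ : A ≠ C₁) (hAC₂ : A ≠ C₂)
    (hC₁₂ : C₁ ≠ C₂) (hAB : A₁ ≠ B₁) (hAC : A₁ ≠ C₁) (hBC : B₁ ≠ C₁) : P ≠ A₁ := by
  rintro rfl
  obtain ⟨s, hs⟩ := cospherical_iff_exists_sphere.1 h
  simp only [Set.insert_subset_iff, Set.singleton_subset_iff, Sphere.mem_coe] at hs
  obtain ⟨hA, hB, hC, hP⟩ := hs
  have hsΓ : s = Γ := by
    by_contra hne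
    rcases eq_of_mem_sphere_of_mem_sphere_of_finrank_eq_two Complex.finrank_real_complex hne hBC
      hB hC hP hB₁ hC₁ hA₁ with h | h
    exacts [hAB h, hAC h]
  subst hsΓ
  exact affineIndependent_iff_not_collinear_set.1
    (s.cospherical.affineIndependent_of_mem_of_ne hA hC₁ hC₂ hAC₁ hAC₂ hC₁₂) hcol

/- STATEMENT 4: P and Q (the Miquel points of A₁B₁C₁ and A₂B₂C₂ in ABC, where a
circle Γ centered at O meets BC at A₁, A₂, CA at B₁, B₂, AB at C₁, C₂) are isogonal
conjugates in triangle ABC, and ∡PA₁A₂ = ∡PB₁B₂ = ∡PC₁C₂ = −∡QA₂A₁ = −∡QB₂B₁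
= −∡QC₂C₁ as directed angles mod π (encoded by doubling angles mod 2π).
The plane is modelled by ℂ. -/

theorem generalized_brocard_points_isogonal
    (A B C O : ℂ)
    -- triangle ABC is nondegenerate
    (hABC : AffineIndependent ℝ ![A, B, C])
    -- Γ is a circle with center O meeting the sidelines in the six points
    (Γ : EuclideanGeometry.Sphere ℂ) (hO : Γ.center = O)
    (A₁ A₂ B₁ B₂ C₁ C₂ : ℂ)
    (hA₁Γ : A₁ ∈ Γ) (hA₂Γ : A₂ ∈ Γ) (hB₁Γ : B₁ ∈ Γ)
    (hB₂Γ : B₂ ∈ Γ) (hC₁Γ : C₁ ∈ Γ) (hC₂Γ : C₂ ∈ Γ)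
    (hA₁ : A₁ ∈ line[ℝ, B, C]) (hA₂ : A₂ ∈ line[ℝ, B, C])
    (hB₁ : B₁ ∈ line[ℝ, C, A]) (hB₂ : B₂ ∈ line[ℝ, C, A])
    (hC₁ : C₁ ∈ line[ℝ, A, B]) (hC₂ : C₂ ∈ line[ℝ, A, B])
    -- the six points are distinct from each other and from the vertices
    (hdist : List.Pairwise (· ≠ ·) [A, B, C, A₁, A₂, B₁, B₂, C₁, C₂])
    -- P is the Miquel point of A₁B₁C₁ in ABC, Q that of A₂B₂C₂
    (P Q : ℂ)
    (hP₁ : Cospherical ({A, B₁, C₁, P} : Set ℂ))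
    (hP₂ : Cospherical ({B, C₁, A₁, P} : Set ℂ))
    (hP₃ : Cospherical ({C, A₁, B₁, P} : Set ℂ))
    (hQ₁ : Cospherical ({A, B₂, C₂, Q} : Set ℂ))
    (hQ₂ : Cospherical ({B, C₂, A₂, Q} : Set ℂ))
    (hQ₃ : Cospherical ({C, A₂, B₂, Q} : Set ℂ))
    :
    -- P and Q are isogonal conjugates in ABC …
    (((2 : ℤ) • ∡ P A B = (2 : ℤ) • ∡ C A Q) ∧
     ((2 : ℤ) • ∡ P B C = (2 : ℤ) • ∡ A B Q) ∧
     ((2 : ℤ) • ∡ P C A = (2 : ℤ) • ∡ B C Q)) ∧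
    -- … and the chain of directed-angle equalities holds
    ((2 : ℤ) • ∡ P A₁ A₂ = (2 : ℤ) • ∡ P B₁ B₂ ∧
     (2 : ℤ) • ∡ P B₁ B₂ = (2 : ℤ) • ∡ P C₁ C₂ ∧
     (2 : ℤ) • ∡ P C₁ C₂ = -((2 : ℤ) • ∡ Q A₂ A₁) ∧
     -((2 : ℤ) • ∡ Q A₂ A₁) = -((2 : ℤ) • ∡ Q B₂ B₁) ∧
     -((2 : ℤ) • ∡ Q B₂ B₁) = -((2 : ℤ) • ∡ Q C₂ C₁)) := by
  subst hO
  simp only [List.pairwise_cons, List.mem_cons, List.not_mem_nil, or_false, forall_eq_or_imp,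
    forall_eq] at hdist
  obtain ⟨⟨hAB, hAC, -, -, hAB₁, hAB₂, hAC₁, hAC₂⟩, ⟨hBC, hBA₁, hBA₂, -, -, hBC₁, hBC₂⟩,
    ⟨hCA₁, hCA₂, hCB₁, hCB₂, -, -⟩, ⟨hA₁₂, hA₁B₁, -, hA₁C₁, -⟩, ⟨-, hA₂B₂, -, hA₂C₂⟩,
    ⟨hB₁₂, hB₁C₁, -⟩, ⟨-, hB₂C₂⟩, hC₁₂, -⟩ := hdist
  have colA := collinear_insert_insert_of_mem_affineSpan_pair hA₁ hA₂
  have colB := collinear_insert_insert_of_mem_affineSpan_pair hB₁ hB₂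
  have colC := collinear_insert_insert_of_mem_affineSpan_pair hC₁ hC₂
  have cosΓ {X Y Z W : ℂ} (hX : X ∈ Γ) (hY : Y ∈ Γ) (hZ : Z ∈ Γ) (hW : W ∈ Γ) :
      Cospherical ({X, Y, Z, W} : Set ℂ) :=
    Γ.cospherical.subset (by simp only [Set.insert_subset_iff, Set.singleton_subset_iff, Sphere.mem_coe,
      hX, hY, hZ, hW, and_self])
  have hPA : P ≠ A :=
    ne_of_cospherical_of_collinear hP₂ (colC.subset (by simp [Set.insert_subset_iff])) hAB hAC₁ hBC₁
  have hPB : P ≠ B :=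
    ne_of_cospherical_of_collinear hP₃ (colA.subset (by simp [Set.insert_subset_iff])) hBC hBA₁ hCA₁
  have hPC : P ≠ C :=
    ne_of_cospherical_of_collinear hP₁ (colB.subset (by simp [Set.insert_subset_iff])) hAC.symm hCB₁ hAB₁
  have hQA : Q ≠ A :=
    ne_of_cospherical_of_collinear hQ₂ (colC.subset (by simp [Set.insert_subset_iff])) hAB hAC₂ hBC₂
  have hQB : Q ≠ B :=
    ne_of_cospherical_of_collinear hQ₃ (colA.subset (by simp [Set.insert_subset_iff])) hBC hBA₂ hCA₂
  have hQC : Q ≠ C :=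
    ne_of_cospherical_of_collinear hQ₁ (colB.subset (by simp [Set.insert_subset_iff])) hAC.symm hCB₂ hAB₂
  have hPA₁ : P ≠ A₁ := ne_of_cospherical_of_mem_sphere hP₁ hA₁Γ hB₁Γ hC₁Γ hC₂Γ
    (colC.subset (by simp [Set.insert_subset_iff])) hAC₁ hAC₂ hC₁₂ hA₁B₁ hA₁C₁ hB₁C₁
  have hPB₁ : P ≠ B₁ := ne_of_cospherical_of_mem_sphere hP₂ hB₁Γ hC₁Γ hA₁Γ hA₂Γ
    (colA.subset (by simp [Set.insert_subset_iff])) hBA₁ hBA₂ hA₁₂ hB₁C₁ hA₁B₁.symm hA₁C₁.symm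
  have hPC₁ : P ≠ C₁ := ne_of_cospherical_of_mem_sphere hP₃ hC₁Γ hA₁Γ hB₁Γ hB₂Γ
    (colB.subset (by simp [Set.insert_subset_iff])) hCB₁ hCB₂ hB₁₂ hA₁C₁.symm hB₁C₁.symm hA₁B₁
  have hQA₂ : Q ≠ A₂ := ne_of_cospherical_of_mem_sphere hQ₁ hA₂Γ hB₂Γ hC₂Γ hC₁Γ
    (colC.subset (by simp [Set.insert_subset_iff])) hAC₂ hAC₁ hC₁₂.symm hA₂B₂ hA₂C₂ hB₂C₂
  have hQB₂ : Q ≠ B₂ := ne_of_cospherical_of_mem_sphere hQ₂ hB₂Γ hC₂Γ hA₂Γ hA₁Γ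
    (colA.subset (by simp [Set.insert_subset_iff])) hBA₂ hBA₁ hA₁₂.symm hB₂C₂ hA₂B₂.symm hA₂C₂.symm
  have hQC₂ : Q ≠ C₂ := ne_of_cospherical_of_mem_sphere hQ₃ hC₂Γ hA₂Γ hB₂Γ hB₁Γ
    (colB.subset (by simp [Set.insert_subset_iff])) hCB₂ hCB₁ hB₁₂.symm hA₂C₂.symm hB₂C₂.symm hA₂B₂
  have pBC : (2 : ℤ) • ∡ P B₁ B₂ = (2 : ℤ) • ∡ P C₁ C₂ :=
    two_zsmul_oangle_eq_of_cospherical_of_collinear hP₁ (colB.subset (by simp [Set.insert_subset_iff]))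
      (colC.subset (by simp [Set.insert_subset_iff])) hAB₁ hAC₁ hB₁₂ hC₁₂ hPB₁ hPC₁
  have pAB : (2 : ℤ) • ∡ P A₁ A₂ = (2 : ℤ) • ∡ P B₁ B₂ :=
    two_zsmul_oangle_eq_of_cospherical_of_collinear hP₃ (colA.subset (by simp [Set.insert_subset_iff]))
      (colB.subset (by simp [Set.insert_subset_iff])) hCA₁ hCB₁ hA₁₂ hB₁₂ hPA₁ hPB₁
  have qBC : (2 : ℤ) • ∡ Q B₂ B₁ = (2 : ℤ) • ∡ Q C₂ C₁ :=
    two_zsmul_oangle_eq_of_cospherical_of_collinear hQ₁ (colB.subset (by simp [Set.insert_subset_iff]))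
      (colC.subset (by simp [Set.insert_subset_iff])) hAB₂ hAC₂ hB₁₂.symm hC₁₂.symm hQB₂ hQC₂
  have qAB : (2 : ℤ) • ∡ Q A₂ A₁ = (2 : ℤ) • ∡ Q B₂ B₁ :=
    two_zsmul_oangle_eq_of_cospherical_of_collinear hQ₃ (colA.subset (by simp [Set.insert_subset_iff]))
      (colB.subset (by simp [Set.insert_subset_iff])) hCA₂ hCB₂ hA₁₂.symm hB₁₂.symm hQA₂ hQB₂
  have hA : (2 : ℤ) • ∡ P A₁ A₂ = -((2 : ℤ) • ∡ Q A₂ A₁) := by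
    rw [← smul_neg, ← oangle_rev]
    exact two_zsmul_oangle_miquel_eq hABC hA₁ hA₂ hB₁ hB₂ hC₁ hC₂ hA₁₂ hB₁₂ hC₁₂
      (hA₁Γ.trans hA₂Γ.symm) (hB₁Γ.trans hB₂Γ.symm) (hC₁Γ.trans hC₂Γ.symm)
      hPA₁ hPB₁ hPC₁ hQA₂ hQB₂ hQC₂ pAB (pAB.trans pBC) qAB (qAB.trans qBC)
  have toRev {X Y Z U V W : ℂ} (h : (2 : ℤ) • ∡ X Y Z = -((2 : ℤ) • ∡ U V W)) :
      (2 : ℤ) • ∡ X Y Z = (2 : ℤ) • ∡ W V U := by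
    rw [h, oangle_rev U, smul_neg]
  refine ⟨⟨?_, ?_, ?_⟩, pAB, pBC, by rw [← pBC, ← pAB, hA], by rw [qAB], by rw [qBC]⟩
  · exact two_zsmul_oangle_isogonal hP₁ hQ₁ (cosΓ hB₂Γ hB₁Γ hC₂Γ hC₁Γ)
      (colB.subset (by simp [Set.insert_subset_iff])) (colC.subset (by simp [Set.insert_subset_iff])) hAB.symm hAC.symm hAB₂ hAC₁
      hB₁₂ hC₁₂ hB₁C₁ hB₂C₂ hPA hPB₁ hQA hQC₂
      (toRev (by rw [← pAB, ← qBC, ← qAB, hA]))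
  · exact two_zsmul_oangle_isogonal hP₂ hQ₂ (cosΓ hC₂Γ hC₁Γ hA₂Γ hA₁Γ)
      (colC.subset (by simp [Set.insert_subset_iff])) (colA.subset (by simp [Set.insert_subset_iff])) hBC.symm hAB hBC₂ hBA₁
      hC₁₂ hA₁₂ hA₁C₁.symm hA₂C₂.symm hPB hPC₁ hQB hQA₂
      (toRev (by rw [← pBC, ← pAB, hA]))
  · exact two_zsmul_oangle_isogonal hP₃ hQ₃ (cosΓ hA₂Γ hA₁Γ hB₂Γ hB₁Γ)
      (colA.subset (by simp [Set.insert_subset_iff])) (colB.subset (by simp [Set.insert_subset_iff])) hAC hBC hCA₂ hCB₁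
      hA₁₂ hB₁₂ hA₁B₁ hA₂B₂ hPC hPA₁ hQC hQB₂
      (toRev (by rw [← qAB, hA]))
end

section
/- Let T_A = PA₁ ∩ QA₂, T_B = PB₁ ∩ QB₂, T_C = PC₁ ∩ QC₂, let A' be the second intersection point (distinct from A) of the circumcircles of triangles AB₁C₁ and AB₂C₂ (and B', C' defined analogously), and let R be the common point of the lines AA', BB', CC'. Then the ten points P, Q, O, R, A', B', C', T_A, T_B, T_C all lie on one circle. -/
open EuclideanGeometry

open scoped ComplexConjugate

/-- If `z` is a multiple of its conjugate, so is every real multiple of `z`, with the same factor. -/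
lemma eq_mul_conj_of_parallel {y z δ : ℂ} (hz : z ≠ 0) (h : z = δ * conj z)
    (hy : y * conj z = conj y * z) : y = δ * conj y := by
  have hz' : conj z ≠ 0 := by simpa using hz
  apply mul_right_cancel₀ hz'
  linear_combination hy + conj y * h

lemma eq_zero_of_two_directions {z δ ε : ℂ} (hne : δ ≠ ε) (h₁ : z = δ * conj z)
    (h₂ : z = ε * conj z) : z = 0 := by
  have h : (δ - ε) * conj z = 0 := by linear_combination h₂ - h₁
  simpa [sub_ne_zero.2 hne] using h

lemma mul_conj_eq_of_mem_line {x y z : ℂ} (h : z ∈ line[ℝ, x, y]) :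
    (z - x) * conj (y - x) = conj (z - x) * (y - x) := by
  obtain ⟨t, rfl⟩ := mem_affineSpan_pair_iff_exists_lineMap_eq.1 h
  simp [AffineMap.lineMap_apply]
  ring

lemma mul_conj_ne_of_affineIndependent {A B C : ℂ} (h : AffineIndependent ℝ ![A, B, C]) :
    (B - A) * conj (C - A) ≠ conj (B - A) * (C - A) := by
  intro hBC
  rw [affineIndependent_iff_not_collinear_set] at h
  apply h
  by_cases hAB : B - A = 0
  · rw [sub_eq_zero.1 hAB]
    simpa using collinear_pair ℝ A C
  rw [collinear_iff_of_mem (p₀ := A) (by simp)]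
  have hreal : conj ((C - A) / (B - A)) = (C - A) / (B - A) := by
    have : conj (B - A) ≠ 0 := (map_ne_zero _).2 hAB
    rw [map_div₀, div_eq_div_iff this hAB]
    linear_combination hBC
  obtain ⟨t, ht⟩ := Complex.conj_eq_iff_real.1 hreal
  rw [div_eq_iff hAB] at ht
  refine ⟨B - A, ?_⟩
  simp only [Set.mem_insert_iff, Set.mem_singleton_iff, forall_eq_or_imp, forall_eq]
  refine ⟨⟨0, by simp⟩, ⟨1, by simp⟩, ⟨t, ?_⟩⟩
  simp only [Complex.real_smul, vadd_eq_add]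
  linear_combination ht

lemma dist_eq_iff_mul_conj {x m : ℂ} {r : ℝ} (h : dist x m = r) :
    (x - m) * conj (x - m) = (r : ℂ) ^ 2 := by
  rw [Complex.mul_conj, Complex.normSq_eq_norm_sq, ← dist_eq_norm, h]
  push_cast
  rfl

lemma cross_ratio_real_of_mul_conj {x y z t m ρ : ℂ} (hx : (x - m) * conj (x - m) = ρ)
    (hy : (y - m) * conj (y - m) = ρ) (hz : (z - m) * conj (z - m) = ρ)
    (ht : (t - m) * conj (t - m) = ρ) :
    (x - y) * (z - t) * conj ((x - z) * (y - t)) =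
      conj ((x - y) * (z - t)) * ((x - z) * (y - t)) := by
  obtain ⟨x, rfl⟩ : ∃ u, x = u + m := ⟨x - m, by ring⟩
  obtain ⟨y, rfl⟩ : ∃ u, y = u + m := ⟨y - m, by ring⟩
  obtain ⟨z, rfl⟩ : ∃ u, z = u + m := ⟨z - m, by ring⟩
  obtain ⟨t, rfl⟩ : ∃ u, t = u + m := ⟨t - m, by ring⟩
  simp only [add_sub_cancel_right, add_sub_add_right_eq_sub, map_mul, map_sub] at *
  by_cases hρ : ρ = 0
  · subst hρ
    simp_all
  have key : ∀ u : ℂ, u * conj u = ρ → u ≠ 0 ∧ conj u = ρ / u := by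
    intro u hu
    have : u ≠ 0 := by rintro rfl; simp_all
    exact ⟨this, by rw [eq_div_iff this, ← hu]; ring⟩
  obtain ⟨hx0, hx⟩ := key x hx
  obtain ⟨hy0, hy⟩ := key y hy
  obtain ⟨hz0, hz⟩ := key z hz
  obtain ⟨ht0, ht⟩ := key t ht
  rw [hx, hy, hz, ht]
  field_simp
  ring

lemma cross_ratio_real_of_cospherical {x y z t : ℂ} (h : Cospherical ({x, y, z, t} : Set ℂ)) :
    (x - y) * (z - t) * conj ((x - z) * (y - t)) =
      conj ((x - y) * (z - t)) * ((x - z) * (y - t)) := by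
  obtain ⟨m, r, h⟩ := h
  exact cross_ratio_real_of_mul_conj (dist_eq_iff_mul_conj (h x (by simp)))
    (dist_eq_iff_mul_conj (h y (by simp))) (dist_eq_iff_mul_conj (h z (by simp)))
    (dist_eq_iff_mul_conj (h t (by simp)))

/-- Two quadruples of concyclic points sharing three noncollinear points lie on one circle. -/
lemma cross_ratio_real_of_two_cospherical {x y z p q : ℂ}
    (hp : Cospherical ({x, y, z, p} : Set ℂ)) (hq : Cospherical ({x, y, z, q} : Set ℂ))
    (hxyz : (y - x) * conj (z - x) ≠ conj (y - x) * (z - x)) :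
    (x - y) * (q - p) * conj ((x - q) * (y - p)) =
      conj ((x - y) * (q - p)) * ((x - q) * (y - p)) := by
  obtain ⟨m, r, hm⟩ := hp
  obtain ⟨n, s, hn⟩ := hq
  have e₁ := dist_eq_iff_mul_conj (hm x (by simp))
  have e₂ := dist_eq_iff_mul_conj (hm y (by simp))
  have e₃ := dist_eq_iff_mul_conj (hm z (by simp))
  have f₁ := dist_eq_iff_mul_conj (hn x (by simp))
  have f₂ := dist_eq_iff_mul_conj (hn y (by simp))
  have f₃ := dist_eq_iff_mul_conj (hn z (by simp))
  have hmn : m = n := by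
    have g₁ : (m - n) * conj (y - x) + conj (m - n) * (y - x) = 0 := by
      simp only [map_sub] at *
      linear_combination e₁ - e₂ - f₁ + f₂
    have g₂ : (m - n) * conj (z - x) + conj (m - n) * (z - x) = 0 := by
      simp only [map_sub] at *
      linear_combination e₁ - e₃ - f₁ + f₃
    have g : (m - n) * ((y - x) * conj (z - x) - conj (y - x) * (z - x)) = 0 := by
      linear_combination (y - x) * g₂ - (z - x) * g₁
    exact sub_eq_zero.1 ((mul_eq_zero.1 g).resolve_right (sub_ne_zero.2 hxyz))
  subst hmn
  have hrs : (s : ℂ) ^ 2 = (r : ℂ) ^ 2 := f₁.symm.trans e₁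
  exact cross_ratio_real_of_mul_conj e₁ e₂ ((dist_eq_iff_mul_conj (hn q (by simp))).trans hrs)
    (dist_eq_iff_mul_conj (hm p (by simp)))

/-- The reflection factor of a chord `b₁b₂` of a circle with center `O` whose line is `XY`. -/
lemma exists_chord_direction {X Y O b₁ b₂ ρ : ℂ} (hρ : ρ ≠ 0)
    (h₁ : (b₁ - O) * conj (b₁ - O) = ρ) (h₂ : (b₂ - O) * conj (b₂ - O) = ρ)
    (hb : b₁ ≠ b₂) (hXY : X ≠ Y) (hb₁ : b₁ ∈ line[ℝ, X, Y]) (hb₂ : b₂ ∈ line[ℝ, X, Y]) :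
    ∃ β : ℂ, β * ρ = (b₁ - O) * (b₂ - O) ∧ β * conj (b₁ - O) = b₂ - O ∧
      β * conj (b₂ - O) = b₁ - O ∧ β * conj β = 1 ∧
      X - Y = -β * conj (X - Y) ∧ X - b₁ = -β * conj (X - b₁) ∧ X - b₂ = -β * conj (X - b₂) ∧
      Y - b₁ = -β * conj (Y - b₁) ∧ Y - b₂ = -β * conj (Y - b₂) := by
  have c₁ := mul_conj_eq_of_mem_line hb₁
  have c₂ := mul_conj_eq_of_mem_line hb₂
  set β := (b₁ - O) * (b₂ - O) / ρ with hβ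
  have e₁ : β * conj (b₁ - O) = b₂ - O := by
    rw [hβ]; field_simp; linear_combination (b₂ - O) * h₁
  have e₂ : β * conj (b₂ - O) = b₁ - O := by
    rw [hβ]; field_simp; linear_combination (b₁ - O) * h₂
  have hbb : b₁ - b₂ = -β * conj (b₁ - b₂) := by
    simp only [map_sub] at *
    linear_combination e₁ - e₂
  have hXY' : X - Y = -β * conj (X - Y) := by
    apply eq_mul_conj_of_parallel (sub_ne_zero.2 hb) hbb
    simp only [map_sub] at *
    linear_combination c₁ - c₂
  have g₁ : b₁ - X = -β * conj (b₁ - X) := by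
    apply eq_mul_conj_of_parallel (sub_ne_zero.2 hXY) hXY'
    simp only [map_sub] at *
    linear_combination -c₁
  have hββ : β * conj β = 1 := by
    have : conj (b₁ - O) ≠ 0 := by
      intro h
      rw [h, mul_zero] at h₁
      exact hρ h₁.symm
    apply mul_right_cancel₀ this
    have e₂' := congrArg conj e₂
    simp only [map_mul, Complex.conj_conj] at e₂'
    linear_combination conj β * e₁ + e₂'
  refine ⟨β, by rw [hβ]; field_simp, e₁, e₂, hββ, hXY', ?_, ?_, ?_, ?_⟩ <;>
    simp only [map_sub] at *
  · linear_combination -g₁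
  · linear_combination hbb - g₁
  · linear_combination -hXY' - g₁
  · linear_combination hbb - hXY' - g₁

/-- The Miquel point differs from the vertices of the inscribed triangle. -/
lemma miquel_ne {O A a b c b' c' P β γ ρ : ℂ} (hρ : ρ ≠ 0)
    (ha : (a - O) * conj (a - O) = ρ) (hb : (b - O) * conj (b - O) = ρ)
    (hc : (c - O) * conj (c - O) = ρ)
    (hβ : β * ρ = (b - O) * (b' - O)) (hγ : γ * ρ = (c - O) * (c' - O))
    (hAb : A - b = -β * conj (A - b)) (hAc : A - c = -γ * conj (A - c))
    (hab : a ≠ b) (hac : a ≠ c) (hAbne : A ≠ b) (hAcne : A ≠ c) (hb'c' : b' ≠ c')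
    (h : Cospherical ({A, b, c, P} : Set ℂ)) : P ≠ a := by
  rintro rfl
  have hcr := cross_ratio_real_of_cospherical h
  have chord : ∀ u : ℂ, (u - O) * conj (u - O) = ρ →
      ρ * (u - P) = -(P - O) * (u - O) * conj (u - P) := by
    intro u hu
    simp only [map_sub] at *
    linear_combination (P - O) * hu - (u - O) * ha
  have h₁ := chord b hb
  have h₂ := chord c hc
  have n₁ : conj (A - b) ≠ 0 := (map_ne_zero _).2 (sub_ne_zero.2 hAbne)
  have n₂ : conj (A - c) ≠ 0 := (map_ne_zero _).2 (sub_ne_zero.2 hAcne)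
  have n₃ : conj (b - P) ≠ 0 := (map_ne_zero _).2 (sub_ne_zero.2 hab.symm)
  have n₄ : conj (c - P) ≠ 0 := (map_ne_zero _).2 (sub_ne_zero.2 hac.symm)
  have nz : ∀ u : ℂ, (u - O) * conj (u - O) = ρ → u - O ≠ 0 := by
    intro u hu h0
    rw [h0, zero_mul] at hu
    exact hρ hu.symm
  have hfac : (conj (A - b) * conj (A - c) * conj (b - P) * conj (c - P)) *
      ((P - O) * (b - O) * (c - O) * (b' - c')) = 0 := by
    simp only [map_mul] at hcr
    have e : β * ρ * (c - O) - γ * ρ * (b - O) = (b - O) * (c - O) * (b' - c') := by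
      rw [hβ, hγ]; ring
    have e' : conj (A - b) * conj (A - c) * conj (b - P) * conj (c - P) *
        ((P - O) * (β * (c - O) - γ * (b - O))) = 0 := by
      generalize conj (A - b) = x at *
      generalize conj (A - c) = y at *
      generalize conj (b - P) = z at *
      generalize conj (c - P) = t at *
      rw [hAb, hAc] at hcr
      linear_combination ρ * hcr + β * x * y * z * h₂ - γ * x * y * t * h₁
    linear_combination ρ * e' - conj (A - b) * conj (A - c) * conj (b - P) * conj (c - P) *
      (P - O) * e
  simp only [mul_eq_zero, n₁, n₂, n₃, n₄, nz P ha, nz b hb, nz c hc, false_or] at hfac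
  exact hb'c' (sub_eq_zero.1 hfac)

/-- The lines from the Miquel point make the same angle with the sides. -/
lemma miquel_direction {C a b P α β w : ℂ} (h : Cospherical ({C, a, b, P} : Set ℂ))
    (hCa : C - a = -α * conj (C - a)) (hCb : C - b = -β * conj (C - b))
    (hα : α ≠ 0) (hCane : C ≠ a) (hCbne : C ≠ b) (hPa : P ≠ a)
    (hw : P - a = w * α * conj (P - a)) : P - b = w * β * conj (P - b) := by
  have hcr := cross_ratio_real_of_cospherical h
  have n₁ : conj (C - a) ≠ 0 := (map_ne_zero _).2 (sub_ne_zero.2 hCane)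
  have n₂ : conj (C - b) ≠ 0 := (map_ne_zero _).2 (sub_ne_zero.2 hCbne)
  have n₃ : conj (P - a) ≠ 0 := (map_ne_zero _).2 (sub_ne_zero.2 hPa)
  apply mul_left_cancel₀ (mul_ne_zero hα (mul_ne_zero n₁ (mul_ne_zero n₂ n₃)))
  rw [← neg_sub P a, ← neg_sub P b] at hcr
  simp only [map_mul, map_neg] at hcr
  generalize conj (C - a) = x at *
  generalize conj (C - b) = y at *
  generalize conj (P - a) = z at *
  generalize conj (P - b) = t at *
  rw [hCa, hCb, hw] at hcr
  linear_combination -hcr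

/-- For a triangle `abc` inscribed in a circle, the Miquel point `P` sees the points `a`, `b`, `c`
along lines obtained by rotating the corresponding sides through a common angle. -/
lemma exists_miquel_rotation {O A B C a b c a' b' c' P α β γ ρ : ℂ} (hρ : ρ ≠ 0)
    (ha : (a - O) * conj (a - O) = ρ) (hb : (b - O) * conj (b - O) = ρ)
    (hc : (c - O) * conj (c - O) = ρ) (hα : α * ρ = (a - O) * (a' - O))
    (hβ : β * ρ = (b - O) * (b' - O)) (hγ : γ * ρ = (c - O) * (c' - O))
    (hα1 : α * conj α = 1) (hβ1 : β * conj β = 1)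
    (hAb : A - b = -β * conj (A - b)) (hAc : A - c = -γ * conj (A - c))
    (hBa : B - a = -α * conj (B - a)) (hBc : B - c = -γ * conj (B - c))
    (hCa : C - a = -α * conj (C - a)) (hCb : C - b = -β * conj (C - b))
    (hab : a ≠ b) (hac : a ≠ c) (hbc : b ≠ c) (nAb : A ≠ b) (nAc : A ≠ c) (nBa : B ≠ a)
    (nBc : B ≠ c) (nCa : C ≠ a) (nCb : C ≠ b)
    (hab' : a' ≠ b') (hac' : a' ≠ c') (hbc' : b' ≠ c')
    (h₁ : Cospherical ({A, b, c, P} : Set ℂ)) (h₂ : Cospherical ({B, c, a, P} : Set ℂ))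
    (h₃ : Cospherical ({C, a, b, P} : Set ℂ)) :
    ∃ w : ℂ, w * conj w = 1 ∧ P - a = w * α * conj (P - a) ∧ P - b = w * β * conj (P - b) ∧
      P - c = w * γ * conj (P - c) ∧ P ≠ a ∧ P ≠ b ∧ P ≠ c := by
  have na : P ≠ a := miquel_ne hρ ha hb hc hβ hγ hAb hAc hab hac nAb nAc hbc' h₁
  have nb : P ≠ b :=
    miquel_ne hρ hb hc ha hγ hα hBc hBa hbc hab.symm nBc nBa hac'.symm h₂
  have nc : P ≠ c :=
    miquel_ne hρ hc ha hb hα hβ hCa hCb hac.symm hbc.symm nCa nCb hab' h₃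
  have α0 : α ≠ 0 := left_ne_zero_of_mul_eq_one hα1
  have β0 : β ≠ 0 := left_ne_zero_of_mul_eq_one hβ1
  have n₁ : conj (P - a) ≠ 0 := (map_ne_zero _).2 (sub_ne_zero.2 na)
  have n₂ : P - a ≠ 0 := sub_ne_zero.2 na
  have hw : P - a = (P - a) / (α * conj (P - a)) * α * conj (P - a) := by field_simp
  have hwb := miquel_direction h₃ hCa hCb α0 nCa nCb na hw
  have hwc := miquel_direction h₁ hAb hAc β0 nAb nAc nb hwb
  refine ⟨_, ?_, hw, hwb, hwc, na, nb, nc⟩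
  have α0' : conj α ≠ 0 := by simpa using α0
  rw [map_div₀, map_mul, Complex.conj_conj]
  field_simp
  linear_combination -hα1

/-- The linear system of the Miquel point, in the point, its conjugate and the rotation factor,
is nonsingular. -/
lemma miquel_system_unique {a b c a' b' c' α β γ ρ x y z : ℂ}
    (ha : a * conj a = ρ) (hb : b * conj b = ρ) (hc : c * conj c = ρ)
    (hα : α * ρ = a * a') (hβ : β * ρ = b * b') (hγ : γ * ρ = c * c')
    (haα : α * conj a = a') (hbβ : β * conj b = b') (hcγ : γ * conj c = c')
    (hα1 : α * conj α = 1) (hβ1 : β * conj β = 1) (hγ1 : γ * conj γ = 1)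
    (hab : a ≠ b) (hac : a ≠ c) (hbc : b ≠ c) (hab' : a' ≠ b') (hαβ : α ≠ β)
    (h₁ : x - α * y + a * z = 0) (h₂ : x - β * y + b * z = 0) (h₃ : x - γ * y + c * z = 0) :
    x = 0 ∧ z = 0 := by
  by_cases hz : z = 0
  · subst hz
    have hy : (α - β) * y = 0 := by linear_combination h₂ - h₁
    have hy : y = 0 := (mul_eq_zero.1 hy).resolve_left (sub_ne_zero.2 hαβ)
    exact ⟨by linear_combination h₁ + α * hy, rfl⟩
  exfalso
  obtain ⟨s, rfl⟩ : ∃ s, x = -(s * z) := ⟨-x / z, by field_simp⟩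
  obtain ⟨t, rfl⟩ : ∃ t, y = t * z := ⟨y / z, by field_simp⟩
  have quad : ∀ u u' δ : ℂ, u * conj u = ρ → δ * ρ = u * u' → δ * conj u = u' →
      δ * conj δ = 1 → -(s * z) - δ * (t * z) + u * z = 0 →
      u = s + t * δ ∧ u' = conj s * δ + conj t ∧
        conj s * u ^ 2 + (t * conj t - s * conj s - ρ) * u + s * ρ = 0 := by
    intro u u' δ hu hδ huδ hδ1 h
    have e : u = s + t * δ := mul_right_cancel₀ hz (by linear_combination h)
    have e' : u' = conj s * δ + conj t := by
      have := congrArg conj e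
      simp only [map_add, map_mul] at this
      linear_combination -huδ + δ * this + conj t * hδ1
    refine ⟨e, e', ?_⟩
    linear_combination (conj s * u - ρ) * e - t * hδ - u * t * e'
  obtain ⟨ea, ea', qa⟩ := quad a a' α ha hα haα hα1 h₁
  obtain ⟨eb, eb', qb⟩ := quad b b' β hb hβ hbβ hβ1 h₂
  obtain ⟨-, -, qc⟩ := quad c c' γ hc hγ hcγ hγ1 h₃
  have r₁ : conj s * (a + b) + (t * conj t - s * conj s - ρ) = 0 :=
    mul_left_cancel₀ (sub_ne_zero.2 hab) (by linear_combination qa - qb)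
  have r₂ : conj s * (a + c) + (t * conj t - s * conj s - ρ) = 0 :=
    mul_left_cancel₀ (sub_ne_zero.2 hac) (by linear_combination qa - qc)
  have hs : conj s = 0 :=
    mul_left_cancel₀ (sub_ne_zero.2 hbc) (by linear_combination r₁ - r₂)
  exact hab' (by rw [ea', eb', hs]; ring)

/-- The two Miquel points have inverse rotation factors `w`, `v`, and `Q = -P / w` relative to the
center of the circle. -/
lemma miquel_points_relation {a b c a' b' c' α β γ ρ p q w v : ℂ}
    (ha : a * conj a = ρ) (hb : b * conj b = ρ) (hc : c * conj c = ρ)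
    (hα : α * ρ = a * a') (hβ : β * ρ = b * b') (hγ : γ * ρ = c * c')
    (haα : α * conj a = a') (hbβ : β * conj b = b') (hcγ : γ * conj c = c')
    (haα' : α * conj a' = a) (hbβ' : β * conj b' = b) (hcγ' : γ * conj c' = c)
    (hα1 : α * conj α = 1) (hβ1 : β * conj β = 1) (hγ1 : γ * conj γ = 1)
    (hab : a ≠ b) (hac : a ≠ c) (hbc : b ≠ c) (hab' : a' ≠ b') (hαβ : α ≠ β)
    (pa : p - a = w * α * conj (p - a)) (pb : p - b = w * β * conj (p - b))
    (pc : p - c = w * γ * conj (p - c)) (qa : q - a' = v * α * conj (q - a'))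
    (qb : q - b' = v * β * conj (q - b')) (qc : q - c' = v * γ * conj (q - c')) :
    w * q = -p ∧ w * v = 1 := by
  simp only [map_sub] at *
  have h : w * q + p = 0 ∧ w * v - 1 = 0 := by
    refine miquel_system_unique (y := w * v * conj q + w * conj p) ha hb hc hα hβ hγ
      haα hbβ hcγ hα1 hβ1 hγ1 hab hac hbc hab' hαβ ?_ ?_ ?_
    · linear_combination w * qa + pa - w * v * haα' - w * haα
    · linear_combination w * qb + pb - w * v * hbβ' - w * hbβ
    · linear_combination w * qc + pc - w * v * hcγ' - w * hcγ
  exact ⟨by linear_combination h.1, by linear_combination h.2⟩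

/-- The angles at the second intersection `Z` of the circle through `X`, `b`, `P`. -/
lemma second_intersection_direction {X b c P Z β w : ℂ} (hP : Cospherical ({X, b, c, P} : Set ℂ))
    (hZ : Cospherical ({X, b, c, Z} : Set ℂ))
    (hXbc : (b - X) * conj (c - X) ≠ conj (b - X) * (c - X))
    (hβ : β ≠ 0) (hX : X - b = -β * conj (X - b)) (hPb : P - b = w * β * conj (P - b))
    (hXne : X ≠ b) (hPne : P ≠ b) :
    (P - Z) * conj (Z - X) = -w * (Z - X) * conj (P - Z) := by
  have hcr := cross_ratio_real_of_two_cospherical hP hZ hXbc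
  have n₁ : conj (X - b) ≠ 0 := (map_ne_zero _).2 (sub_ne_zero.2 hXne)
  have n₂ : conj (P - b) ≠ 0 := (map_ne_zero _).2 (sub_ne_zero.2 hPne)
  apply mul_left_cancel₀ (mul_ne_zero hβ (mul_ne_zero n₁ n₂))
  rw [← neg_sub P b, ← neg_sub P Z, ← neg_sub Z X] at hcr
  simp only [map_mul, map_neg] at hcr
  generalize conj (X - b) = x at *
  generalize conj (P - b) = y at *
  rw [hX, hPb] at hcr
  linear_combination hcr

/-- The second intersection lies on the circle through `O`, `P`, `Q`, and the radical axis passes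
through the antipode `S` of `O`. -/
lemma second_intersection_mem {z x p q s w v : ℂ} (hw : w * conj w = 1) (hwv : w * v = 1)
    (hq : w * q = -p) (hs : (1 - w) * s = 2 * p) (hw1 : w ≠ 1) (hw1' : 1 + w ≠ 0) (hzx : z ≠ x)
    (hp : (p - z) * conj (z - x) = -w * (z - x) * conj (p - z))
    (hqz : (q - z) * conj (z - x) = -v * (z - x) * conj (q - z)) :
    (1 - w) * (z * conj z) = p * conj z - w * conj p * z ∧ 
      (s - x) * conj (z - x) = conj (s - x) * (z - x) := by
  have hv : conj w = v := by
    have : w ≠ 0 := left_ne_zero_of_mul_eq_one hw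
    exact mul_left_cancel₀ this (hw.trans hwv.symm)
  have hq' : conj q = -w * conj p := by
    have := congrArg conj hq
    simp only [map_mul, map_neg, hv] at this
    linear_combination w * this - conj q * hwv
  have hs' : (1 - w) * conj s = -2 * w * conj p := by
    have := congrArg conj hs
    simp only [map_mul, map_sub, map_one, map_ofNat, hv] at this
    linear_combination -w * this - conj s * hwv
  have hD : conj (z - x) ≠ 0 := (map_ne_zero _).2 (sub_ne_zero.2 hzx)
  have hqw : (p + w * z) * conj (z - x) = -(z - x) * (w * conj p + conj z) := by
    rw [map_sub conj q, hq'] at hqz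
    linear_combination -w * hqz + conj (z - x) * hq - (z - x) * (w * conj p + conj z) * hwv
  refine ⟨?_, ?_⟩
  · apply mul_left_cancel₀ (mul_ne_zero hD hw1')
    simp only [map_sub] at *
    linear_combination w * (conj p - conj z) * hqw - (w * conj p + conj z) * hp
  · apply mul_left_cancel₀ (sub_ne_zero.2 hw1.symm)
    simp only [map_sub] at *
    linear_combination hp + hqw + (conj z - conj x) * hs - (z - x) * hs'

lemma lines_intersection_mem {t p q w v α : ℂ} (hwv : w * v = 1)
    (hq : w * q = -p) (hq' : conj q = -w * conj p) (hw : 1 + w ≠ 0)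
    (hp : t - p = w * α * conj (t - p)) (htq : t - q = v * α * conj (t - q)) :
    (1 - w) * (t * conj t) = p * conj t - w * conj p * t := by
  rw [map_sub conj t q, hq'] at htq
  have h : w * t + p = α * (conj t + w * conj p) := by
    linear_combination w * htq + hq + α * (conj t + w * conj p) * hwv
  apply mul_left_cancel₀ hw
  simp only [map_sub] at *
  linear_combination (conj t + w * conj p) * hp - w * (conj t - conj p) * h

lemma rotation_factor_ne_one {a a' p q t w v α : ℂ} (haα : α * conj a = a') (haa' : a ≠ a')
    (hwv : w * v = 1) (hq : w * q = -p) (hpa : p - a = w * α * conj (p - a))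
    (hp : t - p = w * α * conj (t - p)) (htq : t - q = v * α * conj (t - q)) : w ≠ 1 := by
  rintro rfl
  obtain rfl : v = 1 := by simpa using hwv
  obtain rfl : q = -p := by simpa using hq
  apply haa'
  simp only [map_sub, map_neg] at *
  linear_combination -hpa + haα + (htq - hp) / 2

lemma dist_eq_of_circle_equation {X O p w : ℂ} (hw : w * conj w = 1) (hw1 : w ≠ 1)
    (h : (1 - w) * ((X - O) * conj (X - O)) = p * conj (X - O) - w * conj p * (X - O)) :
    dist X (O + p / (1 - w)) = ‖p / (1 - w)‖ := by
  have n : 1 - w ≠ 0 := sub_ne_zero.2 hw1.symm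
  obtain ⟨z, rfl⟩ : ∃ z, X = O + z := ⟨X - O, by ring⟩
  obtain ⟨m, rfl⟩ : ∃ m, p = m * (1 - w) := ⟨p / (1 - w), by field_simp⟩
  rw [mul_div_cancel_right₀ _ n, dist_eq_norm, add_sub_add_left_eq_sub]
  simp only [add_sub_cancel_left, map_mul, map_sub, map_one] at h
  have h' : (z - m) * conj (z - m) = m * conj m := by
    apply mul_left_cancel₀ n
    rw [map_sub]
    linear_combination h + z * conj m * hw
  rw [Complex.mul_conj, Complex.mul_conj, Complex.ofReal_inj, Complex.normSq_eq_norm_sq,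
    Complex.normSq_eq_norm_sq] at h'
  exact (sq_eq_sq₀ (norm_nonneg _) (norm_nonneg _)).1 h'

/-- Three lines through the vertices of a triangle have at most one common point. -/
lemma eq_of_mem_three_cevians {A B C A' B' C' R S β γ : ℂ} (hβγ : β ≠ γ)
    (hCA : C - A = -β * conj (C - A)) (hAB : A - B = -γ * conj (A - B))
    (hBC : C ≠ A) (hABne : A ≠ B) (hA : A' ≠ A) (hB : B' ≠ B) (hC : C' ≠ C)
    (rA : (R - A) * conj (A' - A) = conj (R - A) * (A' - A))
    (rB : (R - B) * conj (B' - B) = conj (R - B) * (B' - B))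
    (rC : (R - C) * conj (C' - C) = conj (R - C) * (C' - C))
    (sA : (S - A) * conj (A' - A) = conj (S - A) * (A' - A))
    (sB : (S - B) * conj (B' - B) = conj (S - B) * (B' - B))
    (sC : (S - C) * conj (C' - C) = conj (S - C) * (C' - C)) : R = S := by
  have parallel : ∀ X X' : ℂ, X' ≠ X → (R - X) * conj (X' - X) = conj (R - X) * (X' - X) →
      (S - X) * conj (X' - X) = conj (S - X) * (X' - X) →
      (R - S) * conj (R - X) = conj (R - S) * (R - X) := by
    intro X X' hX r s
    apply mul_left_cancel₀ ((map_ne_zero conj).2 (sub_ne_zero.2 hX))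
    simp only [map_sub] at *
    linear_combination (conj S - conj X) * r - (conj R - conj X) * s
  have pA := parallel A A' hA rA sA
  have pB := parallel B B' hB rB sB
  have pC := parallel C C' hC rC sC
  apply sub_eq_zero.1
  have e₁ := eq_mul_conj_of_parallel (y := R - S) (sub_ne_zero.2 hBC) hCA (by
    simp only [map_sub] at *; linear_combination pA - pC)
  have e₂ := eq_mul_conj_of_parallel (y := R - S) (sub_ne_zero.2 hABne) hAB (by
    simp only [map_sub] at *; linear_combination pB - pA)
  exact eq_zero_of_two_directions (neg_injective.ne hβγ) e₁ e₂

lemma mul_conj_ne_of_two_directions {X b c β γ : ℂ} (hβγ : β ≠ γ) (hXb : X ≠ b) (hXc : X ≠ c)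
    (hb : X - b = -β * conj (X - b)) (hc : X - c = -γ * conj (X - c)) :
    (b - X) * conj (c - X) ≠ conj (b - X) * (c - X) := by
  intro h
  have := eq_mul_conj_of_parallel (y := X - b) (sub_ne_zero.2 hXc) hc (by
    simp only [map_sub] at *; linear_combination h)
  exact hXb (sub_eq_zero.1 (eq_zero_of_two_directions (neg_injective.ne hβγ) hb this))

/- STATEMENT 7: With T_A = PA₁ ∩ QA₂, T_B = PB₁ ∩ QB₂, T_C = PC₁ ∩ QC₂, A', B', C'
the second intersections of the pairs of circles, and R the common point of AA', BB',
CC', the ten points P, Q, O, R, A', B', C', T_A, T_B, T_C lie on one circle.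
The plane is modelled by ℂ. -/

theorem generalized_brocard_circle
    (A B C O : ℂ)
    -- triangle ABC is nondegenerate
    (hABC : AffineIndependent ℝ ![A, B, C])
    -- Γ is a circle with center O meeting the sidelines in the six points
    (Γ : EuclideanGeometry.Sphere ℂ) (hO : Γ.center = O)
    (A₁ A₂ B₁ B₂ C₁ C₂ : ℂ)
    (hA₁Γ : A₁ ∈ Γ) (hA₂Γ : A₂ ∈ Γ) (hB₁Γ : B₁ ∈ Γ)
    (hB₂Γ : B₂ ∈ Γ) (hC₁Γ : C₁ ∈ Γ) (hC₂Γ : C₂ ∈ Γ)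
    (hA₁ : A₁ ∈ line[ℝ, B, C]) (hA₂ : A₂ ∈ line[ℝ, B, C])
    (hB₁ : B₁ ∈ line[ℝ, C, A]) (hB₂ : B₂ ∈ line[ℝ, C, A])
    (hC₁ : C₁ ∈ line[ℝ, A, B]) (hC₂ : C₂ ∈ line[ℝ, A, B])
    -- the six points are distinct from each other and from the vertices
    (hdist : List.Pairwise (· ≠ ·) [A, B, C, A₁, A₂, B₁, B₂, C₁, C₂])
    -- P is the Miquel point of A₁B₁C₁ in ABC, Q that of A₂B₂C₂
    (P Q : ℂ)
    (hP₁ : Cospherical ({A, B₁, C₁, P} : Set ℂ))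
    (hP₂ : Cospherical ({B, C₁, A₁, P} : Set ℂ))
    (hP₃ : Cospherical ({C, A₁, B₁, P} : Set ℂ))
    (hQ₁ : Cospherical ({A, B₂, C₂, Q} : Set ℂ))
    (hQ₂ : Cospherical ({B, C₂, A₂, Q} : Set ℂ))
    (hQ₃ : Cospherical ({C, A₂, B₂, Q} : Set ℂ))
    -- T_A = PA₁ ∩ QA₂, T_B = PB₁ ∩ QB₂, T_C = PC₁ ∩ QC₂
    (T_A T_B T_C : ℂ)
    (hTA₁ : T_A ∈ line[ℝ, P, A₁]) (hTA₂ : T_A ∈ line[ℝ, Q, A₂])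
    (hTB₁ : T_B ∈ line[ℝ, P, B₁]) (hTB₂ : T_B ∈ line[ℝ, Q, B₂])
    (hTC₁ : T_C ∈ line[ℝ, P, C₁]) (hTC₂ : T_C ∈ line[ℝ, Q, C₂])
    -- A' is the second intersection of circles (AB₁C₁) and (AB₂C₂); B', C' analogous
    (A' B' C' : ℂ)
    (hA'₁ : Cospherical ({A, B₁, C₁, A'} : Set ℂ))
    (hA'₂ : Cospherical ({A, B₂, C₂, A'} : Set ℂ)) (hA'A : A' ≠ A)
    (hB'₁ : Cospherical ({B, C₁, A₁, B'} : Set ℂ))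
    (hB'₂ : Cospherical ({B, C₂, A₂, B'} : Set ℂ)) (hB'B : B' ≠ B)
    (hC'₁ : Cospherical ({C, A₁, B₁, C'} : Set ℂ))
    (hC'₂ : Cospherical ({C, A₂, B₂, C'} : Set ℂ)) (hC'C : C' ≠ C)
    -- R is the common point of the lines AA', BB', CC'
    (R : ℂ)
    (hRA : R ∈ line[ℝ, A, A']) (hRB : R ∈ line[ℝ, B, B']) (hRC : R ∈ line[ℝ, C, C'])
    :
    -- conclusion: the ten points are concyclic
    Concyclic ({P, Q, O, R, A', B', C', T_A, T_B, T_C} : Set ℂ) := by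
  subst hO
  set O := Γ.center
  set ρ : ℂ := (Γ.radius : ℂ) ^ 2
  have on : ∀ x ∈ Γ, (x - O) * conj (x - O) = ρ := fun x hx =>
    dist_eq_iff_mul_conj (EuclideanGeometry.mem_sphere.1 hx)
  have a₁ := on A₁ hA₁Γ
  have a₂ := on A₂ hA₂Γ
  have b₁ := on B₁ hB₁Γ
  have b₂ := on B₂ hB₂Γ
  have c₁ := on C₁ hC₁Γ
  have c₂ := on C₂ hC₂Γ
  simp only [List.pairwise_cons, List.mem_cons, List.not_mem_nil, or_false, forall_eq_or_imp,
    forall_eq, implies_true, List.Pairwise.nil, and_true, IsEmpty.forall_iff]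
    at hdist
  obtain ⟨⟨nAB, nAC, -, -, nAB₁, nAB₂, nAC₁, nAC₂⟩, ⟨nBC, nBA₁, nBA₂, -, -, nBC₁, nBC₂⟩,
    ⟨nCA₁, nCA₂, nCB₁, nCB₂, -, -⟩, ⟨nA₁A₂, nA₁B₁, -, nA₁C₁, -⟩, ⟨-, nA₂B₂, -, nA₂C₂⟩,
    ⟨nB₁B₂, nB₁C₁, -⟩, ⟨-, nB₂C₂⟩, nC₁C₂⟩ := hdist
  have hρ : ρ ≠ 0 := by
    intro h
    rw [h] at a₁ a₂
    simp only [mul_eq_zero, map_eq_zero, or_self, sub_eq_zero] at a₁ a₂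
    exact nA₁A₂ (a₁.trans a₂.symm)
  obtain ⟨α, α0, α1, α2, αα, BC, Ba₁, Ba₂, Ca₁, Ca₂⟩ :=
    exists_chord_direction hρ a₁ a₂ nA₁A₂ nBC hA₁ hA₂
  obtain ⟨β, β0, β1, β2, ββ, CA, Cb₁, Cb₂, Ab₁, Ab₂⟩ :=
    exists_chord_direction hρ b₁ b₂ nB₁B₂ nAC.symm hB₁ hB₂
  obtain ⟨γ, γ0, γ1, γ2, γγ, AB, Ac₁, Ac₂, Bc₁, Bc₂⟩ :=
    exists_chord_direction hρ c₁ c₂ nC₁C₂ nAB hC₁ hC₂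
  have nd := mul_conj_ne_of_affineIndependent hABC
  have hβγ : β ≠ γ := by
    rintro rfl
    apply nd
    simp only [map_sub] at *
    linear_combination -(conj C - conj A) * AB - (conj B - conj A) * CA
  have hγα : γ ≠ α := by
    rintro rfl
    apply nd
    simp only [map_sub] at *
    linear_combination -(conj C - conj A) * AB + (conj B - conj A) * (AB + BC)
  have hαβ : α ≠ β := by
    rintro rfl
    apply nd
    simp only [map_sub] at *
    linear_combination (conj C - conj A) * (BC + CA) - (conj B - conj A) * CA
  have α0' : α * ρ = (A₂ - O) * (A₁ - O) := by rw [α0, mul_comm]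
  have β0' : β * ρ = (B₂ - O) * (B₁ - O) := by rw [β0, mul_comm]
  have γ0' : γ * ρ = (C₂ - O) * (C₁ - O) := by rw [γ0, mul_comm]
  obtain ⟨w, ww, Pa, Pb, Pc, nPa, nPb, nPc⟩ := exists_miquel_rotation hρ a₁ b₁ c₁ α0 β0 γ0 αα ββ
    Ab₁ Ac₁ Ba₁ Bc₁ Ca₁ Cb₁ nA₁B₁ nA₁C₁ nB₁C₁ nAB₁ nAC₁ nBA₁ nBC₁ nCA₁ nCB₁
    nA₂B₂ nA₂C₂ nB₂C₂ hP₁ hP₂ hP₃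
  obtain ⟨v, -, Qa, Qb, Qc, nQa, nQb, nQc⟩ := exists_miquel_rotation hρ a₂ b₂ c₂ α0' β0' γ0' αα ββ
    Ab₂ Ac₂ Ba₂ Bc₂ Ca₂ Cb₂ nA₂B₂ nA₂C₂ nB₂C₂ nAB₂ nAC₂ nBA₂ nBC₂ nCA₂ nCB₂
    nA₁B₁ nA₁C₁ nB₁C₁ hQ₁ hQ₂ hQ₃
  have shift : ∀ x y : ℂ, x - O - (y - O) = x - y := fun x y => sub_sub_sub_cancel_right x y O
  have shift_ne : ∀ {x y : ℂ}, x ≠ y → x - O ≠ y - O := fun h => sub_left_injective.ne h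
  obtain ⟨hq, hwv⟩ := miquel_points_relation (p := P - O) (q := Q - O) (w := w) (v := v)
    a₁ b₁ c₁ α0 β0 γ0 α1 β1 γ1 α2 β2 γ2 αα ββ γγ (shift_ne nA₁B₁) (shift_ne nA₁C₁)
    (shift_ne nB₁C₁) (shift_ne nA₂B₂) hαβ (by simpa only [shift] using Pa)
    (by simpa only [shift] using Pb) (by simpa only [shift] using Pc)
    (by simpa only [shift] using Qa) (by simpa only [shift] using Qb)
    (by simpa only [shift] using Qc)
  have w0 : w ≠ 0 := left_ne_zero_of_mul_eq_one ww
  have hv : conj w = v := mul_left_cancel₀ w0 (ww.trans hwv.symm)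
  have hq' : conj (Q - O) = -w * conj (P - O) := by
    have := congrArg conj hq
    rw [map_mul, map_neg, hv] at this
    linear_combination w * this - conj (Q - O) * hwv
  have toLine : ∀ {T P a δ : ℂ}, T ∈ line[ℝ, P, a] → P ≠ a → P - a = δ * conj (P - a) →
      T - O - (P - O) = δ * conj (T - O - (P - O)) := by
    intro T P a δ hT hne h
    rw [shift]
    apply eq_mul_conj_of_parallel (sub_ne_zero.2 hne) h
    have := mul_conj_eq_of_mem_line hT
    simp only [map_sub] at *
    linear_combination -this
  have w1 : w ≠ 1 := rotation_factor_ne_one α1 (shift_ne nA₁A₂) hwv hq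
    (by simpa only [shift] using Pa) (toLine hTA₁ nPa Pa) (toLine hTA₂ nQa Qa)
  have w1' : 1 + w ≠ 0 := by
    intro h
    obtain rfl : w = -1 := by linear_combination h
    have PA : P = A := sub_eq_zero.1 (eq_zero_of_two_directions (neg_injective.ne hβγ)
      (by simp only [map_sub] at *; linear_combination Pb - Ab₁)
      (by simp only [map_sub] at *; linear_combination Pc - Ac₁))
    have PB : P = B := sub_eq_zero.1 (eq_zero_of_two_directions (neg_injective.ne hγα)
      (by simp only [map_sub] at *; linear_combination Pc - Bc₁)
      (by simp only [map_sub] at *; linear_combination Pa - Ba₁))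
    exact nAB (PA.symm.trans PB)
  have αne : α ≠ 0 := left_ne_zero_of_mul_eq_one αα
  have βne : β ≠ 0 := left_ne_zero_of_mul_eq_one ββ
  have γne : γ ≠ 0 := left_ne_zero_of_mul_eq_one γγ
  have hs : (1 - w) * (2 * (P - O) / (1 - w)) = 2 * (P - O) :=
    mul_div_cancel₀ _ (sub_ne_zero.2 w1.symm)
  set s := 2 * (P - O) / (1 - w) with hsdef
  have second : ∀ {X X' b c b' c' β γ : ℂ}, β ≠ γ → β ≠ 0 → X' ≠ X →
      Cospherical ({X, b, c, P} : Set ℂ) → Cospherical ({X, b, c, X'} : Set ℂ) →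
      Cospherical ({X, b', c', Q} : Set ℂ) → Cospherical ({X, b', c', X'} : Set ℂ) →
      X - b = -β * conj (X - b) → X - c = -γ * conj (X - c) →
      X - b' = -β * conj (X - b') → X - c' = -γ * conj (X - c') →
      X ≠ b → X ≠ c → X ≠ b' → X ≠ c' → P ≠ b → Q ≠ b' →
      P - b = w * β * conj (P - b) → Q - b' = v * β * conj (Q - b') →
      (1 - w) * ((X' - O) * conj (X' - O)) = (P - O) * conj (X' - O) - w * conj (P - O) * (X' - O)
      ∧ (O + s - X) * conj (X' - X) = conj (O + s - X) * (X' - X) := by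
    intro X X' b c b' c' β γ hβγ hβ hX h₁ h₂ h₃ h₄ eb ec eb' ec' nb nc nb' nc' nP nQ hPb hQb
    have d₁ := second_intersection_direction h₁ h₂
      (mul_conj_ne_of_two_directions hβγ nb nc eb ec) hβ eb hPb nb nP
    have d₂ := second_intersection_direction h₃ h₄
      (mul_conj_ne_of_two_directions hβγ nb' nc' eb' ec') hβ eb' hQb nb' nQ
    have := second_intersection_mem (z := X' - O) (x := X - O) ww hwv hq hs w1 w1' (shift_ne hX)
      (by simpa only [shift] using d₁) (by simpa only [shift] using d₂)
    rw [shift, show s - (X - O) = O + s - X by ring] at this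
    exact this
  obtain ⟨mA, sA⟩ := second hβγ βne hA'A hP₁ hA'₁ hQ₁ hA'₂ Ab₁ Ac₁ Ab₂ Ac₂ nAB₁ nAC₁ nAB₂ nAC₂
    nPb nQb Pb Qb
  obtain ⟨mB, sB⟩ := second hγα γne hB'B hP₂ hB'₁ hQ₂ hB'₂ Bc₁ Ba₁ Bc₂ Ba₂ nBC₁ nBA₁ nBC₂ nBA₂
    nPc nQc Pc Qc
  obtain ⟨mC, sC⟩ := second hαβ αne hC'C hP₃ hC'₁ hQ₃ hC'₂ Ca₁ Cb₁ Ca₂ Cb₂ nCA₁ nCB₁ nCA₂ nCB₂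
    nPa nQa Pa Qa
  have hR : R = O + s := eq_of_mem_three_cevians hβγ CA AB nAC.symm nAB hA'A hB'B hC'C
    (mul_conj_eq_of_mem_line hRA) (mul_conj_eq_of_mem_line hRB) (mul_conj_eq_of_mem_line hRC)
    sA sB sC
  have mT : ∀ {T a a' α : ℂ}, T ∈ line[ℝ, P, a] → T ∈ line[ℝ, Q, a'] → P ≠ a → Q ≠ a' →
      P - a = w * α * conj (P - a) → Q - a' = v * α * conj (Q - a') →
      (1 - w) * ((T - O) * conj (T - O)) = (P - O) * conj (T - O) - w * conj (P - O) * (T - O) :=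
    fun h₁ h₂ n₁ n₂ e₁ e₂ =>
      lines_intersection_mem hwv hq hq' w1' (toLine h₁ n₁ e₁) (toLine h₂ n₂ e₂)
  refine ⟨⟨O + (P - O) / (1 - w), ‖(P - O) / (1 - w)‖, ?_⟩,
    coplanar_of_finrank_eq_two _ Complex.finrank_real_complex⟩
  simp only [Set.mem_insert_iff, Set.mem_singleton_iff, forall_eq_or_imp, forall_eq]
  refine ⟨?_, ?_, ?_, ?_, dist_eq_of_circle_equation ww w1 mA,
    dist_eq_of_circle_equation ww w1 mB, dist_eq_of_circle_equation ww w1 mC,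
    dist_eq_of_circle_equation ww w1 (mT hTA₁ hTA₂ nPa nQa Pa Qa),
    dist_eq_of_circle_equation ww w1 (mT hTB₁ hTB₂ nPb nQb Pb Qb),
    dist_eq_of_circle_equation ww w1 (mT hTC₁ hTC₂ nPc nQc Pc Qc)⟩
  · exact dist_eq_of_circle_equation ww w1 (by ring)
  · apply dist_eq_of_circle_equation ww w1
    rw [hq']
    linear_combination (w - 1 + 1) * conj (P - O) * hq
  · simp [dist_eq_norm]
  · rw [hR, hsdef, dist_eq_norm]
    congr 1
    ring
end

section
/- Let T_A = PA₁ ∩ QA₂, T_B = PB₁ ∩ QB₂, T_C = PC₁ ∩ QC₂. Then the line through A parallel to T_BT_C, the line through B parallel to T_CT_A, and the line through C parallel to T_AT_B are concurrent at a point S_t lying on the circumcircle of triangle ABC. -/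
open EuclideanGeometry

open scoped ComplexConjugate

lemma Complex.exists_eq_smul_of_im_mul_conj_eq_zero {z w : ℂ} (hw : w ≠ 0)
    (h : (z * conj w).im = 0) : ∃ t : ℝ, z = t • w := by
  refine ⟨(z * conj w).re / Complex.normSq w, ?_⟩
  have hz : ((z * conj w).re : ℂ) = z * conj w := by
    apply Complex.ext <;> simp only [Complex.ofReal_re, Complex.ofReal_im, h]
  have hn : (Complex.normSq w : ℂ) ≠ 0 := by
    simpa using hw
  rw [Complex.normSq_eq_conj_mul_self] at hn
  rw [Complex.real_smul, Complex.ofReal_div, hz, Complex.normSq_eq_conj_mul_self,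
    div_mul_eq_mul_div, eq_div_iff hn]
  ring

lemma Complex.im_eq_zero_of_conj_eq {z : ℂ} (h : conj z = z) : z.im = 0 :=
  Complex.conj_eq_iff_im.mp h

lemma Complex.exists_eq_smul_sub_of_mem_line {X Y Z : ℂ} (h : X ∈ line[ℝ, Y, Z]) :
    ∃ t : ℝ, X - Y = t * (Z - Y) := by
  obtain ⟨t, rfl⟩ := mem_affineSpan_pair_iff_exists_lineMap_eq.mp h
  exact ⟨t, by simp [AffineMap.lineMap_apply]⟩

lemma Complex.exists_sub_right_eq_smul_of_mem_line {X Y Z : ℂ} (h : X ∈ line[ℝ, Y, Z]) :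
    ∃ t : ℝ, X - Z = t * (Z - Y) := by
  obtain ⟨t, ht⟩ := exists_eq_smul_sub_of_mem_line h
  refine ⟨t - 1, ?_⟩
  push_cast
  linear_combination ht

lemma Complex.mul_conj_sub_eq_of_dist_eq {X o : ℂ} {r : ℝ} (h : dist X o = r) :
    (X - o) * conj (X - o) = (r : ℂ) ^ 2 := by
  rw [Complex.mul_conj, Complex.normSq_eq_norm_sq, ← dist_eq_norm, h]
  push_cast
  rfl

/-- The inscribed angle theorem for the chords `X P`, `Y P` and `X A`, `Y A`, in terms of
direction vectors `b` and `c` of the lines `A X` and `A Y`. -/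
lemma Complex.im_inscribed_angle_eq_zero {A X Y P b c : ℂ}
    (h : Cospherical ({A, X, Y, P} : Set ℂ)) (hX : X ≠ A) (hY : Y ≠ A)
    {s t : ℝ} (hs : X - A = s * b) (ht : Y - A = t * c) :
    ((X - P) * conj b * conj ((Y - P) * conj c)).im = 0 := by
  obtain ⟨o, r, h⟩ := h
  have hA := mul_conj_sub_eq_of_dist_eq (h A (by simp))
  have hXo := mul_conj_sub_eq_of_dist_eq (h X (by simp))
  have hYo := mul_conj_sub_eq_of_dist_eq (h Y (by simp))
  have hP := mul_conj_sub_eq_of_dist_eq (h P (by simp))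
  have hr : (r : ℂ) ≠ 0 := by
    rintro hr
    have h0 : r = 0 := by exact_mod_cast hr
    have h1 := h A (by simp)
    have h2 := h X (by simp)
    rw [h0, dist_eq_zero] at h1 h2
    exact hX (h2.trans h1.symm)
  have hs0 : (s : ℂ) ≠ 0 := by
    intro h0
    rw [h0, zero_mul] at hs
    exact hX (sub_eq_zero.mp hs)
  have ht0 : (t : ℂ) ≠ 0 := by
    intro h0
    rw [h0, zero_mul] at ht
    exact hY (sub_eq_zero.mp ht)
  have key : ∀ {p x y a : ℂ}, p * conj p = (r : ℂ) ^ 2 → x * conj x = (r : ℂ) ^ 2 →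
      y * conj y = (r : ℂ) ^ 2 → a * conj a = (r : ℂ) ^ 2 →
      (conj x - conj p) * (y - p) * (conj y - conj a) * (x - a)
        = (x - p) * (conj y - conj p) * (y - a) * (conj x - conj a) := by
    intro p x y a hp hx hy ha
    have hr2 : (r : ℂ) ^ 2 ≠ 0 := pow_ne_zero 2 hr
    have hp0 : p ≠ 0 := left_ne_zero_of_mul (hp ▸ hr2)
    have hx0 : x ≠ 0 := left_ne_zero_of_mul (hx ▸ hr2)
    have hy0 : y ≠ 0 := left_ne_zero_of_mul (hy ▸ hr2)
    have ha0 : a ≠ 0 := left_ne_zero_of_mul (ha ▸ hr2)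
    rw [eq_div_of_mul_eq hp0 ((mul_comm _ _).trans hp),
      eq_div_of_mul_eq hx0 ((mul_comm _ _).trans hx),
      eq_div_of_mul_eq hy0 ((mul_comm _ _).trans hy),
      eq_div_of_mul_eq ha0 ((mul_comm _ _).trans ha)]
    field_simp
    ring
  have := key hP hXo hYo hA
  simp only [map_sub] at this
  have hs' := congrArg conj hs
  have ht' := congrArg conj ht
  simp only [map_sub, map_mul, conj_ofReal] at hs' ht'
  have e : ((s : ℂ) * t) * (conj (X - P) * b * ((Y - P) * conj c))
      = ((s : ℂ) * t) * ((X - P) * conj b * (conj (Y - P) * c)) := by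
    calc _ = conj (X - P) * (Y - P) * (t * conj c) * (s * b) := by ring
      _ = (X - P) * conj (Y - P) * (t * c) * (s * conj b) := by
        rw [← hs, ← ht, ← hs', ← ht', map_sub, map_sub]
        linear_combination this
      _ = _ := by ring
  apply im_eq_zero_of_conj_eq
  simpa using mul_left_cancel₀ (mul_ne_zero hs0 ht0) e

lemma Complex.im_mul_conj_add_add_eq_zero {U V W : ℂ}
    (hV : (U * conj V).im = 0) (hW : (U * conj W).im = 0) :
    (U * conj (U + V + W)).im = 0 := by
  rw [map_add, map_add, mul_add, mul_add, add_im, add_im, hV, hW, mul_conj, ofReal_im]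
  simp

lemma Complex.im_miquel_eq_zero {A B C D E F P Z : ℂ}
    (hB : Cospherical ({B, F, D, P} : Set ℂ)) (hC : Cospherical ({C, D, E, P} : Set ℂ))
    (hD : D ∈ line[ℝ, B, C]) (hE : E ∈ line[ℝ, C, A]) (hF : F ∈ line[ℝ, A, B])
    (hDB : D ≠ B) (hDC : D ≠ C) (hEC : E ≠ C) (hFB : F ≠ B)
    (hZ : (D - P) * conj (C - B) + (E - P) * conj (A - C) + (F - P) * conj (B - A) = Z) :
    ((D - P) * conj (C - B) * conj Z).im = 0 := by
  obtain ⟨s, hs⟩ := exists_eq_smul_sub_of_mem_line hD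
  obtain ⟨s', hs'⟩ := exists_sub_right_eq_smul_of_mem_line hD
  obtain ⟨t, ht⟩ := exists_eq_smul_sub_of_mem_line hE
  obtain ⟨u, hu⟩ := exists_sub_right_eq_smul_of_mem_line hF
  rw [← hZ]
  exact im_mul_conj_add_add_eq_zero (im_inscribed_angle_eq_zero hC hDC hEC hs' ht)
    (im_inscribed_angle_eq_zero (by rwa [Set.insert_comm D F]) hDB hFB hs hu)

/-- The two intersections of a circle with center `O` and a line of direction `a` are symmetric
about the foot of the perpendicular from `O`. -/
lemma Complex.exists_eq_center_add_of_mem_line {O X Y B C : ℂ} {r : ℝ} (ha : C - B ≠ 0)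
    (hX : dist X O = r) (hY : dist Y O = r) (hXY : X ≠ Y)
    (hXl : X ∈ line[ℝ, B, C]) (hYl : Y ∈ line[ℝ, B, C]) :
    ∃ x m : ℝ, x ≠ 0 ∧ X = O + (x + m * I) * (C - B) ∧ Y = O + (-x + m * I) * (C - B) ∧
      m * normSq (C - B) = ((B - O) * conj (C - B)).im := by
  obtain ⟨s, hs⟩ := exists_eq_smul_sub_of_mem_line hXl
  obtain ⟨t, ht⟩ := exists_eq_smul_sub_of_mem_line hYl
  obtain ⟨⟨x, m⟩, hz⟩ : ∃ z, z = (X - O) / (C - B) := ⟨_, rfl⟩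
  have hz' : X - O = (x + m * I) * (C - B) := by
    rw [← mk_eq_add_mul_I, hz]
    field_simp
  have hY' : Y - O = ((x + (t - s) : ℝ) + m * I) * (C - B) := by
    push_cast
    linear_combination hz' + ht - hs
  have hts : t - s ≠ 0 := by
    intro h
    apply hXY
    have h' : (t : ℂ) - s = 0 := by exact_mod_cast h
    linear_combination hs - ht - (C - B) * h'
  have hn : ‖((x : ℂ) + m * I)‖ = ‖(((x + (t - s) : ℝ) : ℂ) + m * I)‖ := by
    have h := hX.trans hY.symm
    rw [dist_eq_norm, dist_eq_norm, hz', hY', norm_mul, norm_mul] at h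
    exact mul_right_cancel₀ (norm_ne_zero_iff.mpr ha) h
  have hq : normSq ((x : ℂ) + m * I) = normSq (((x + (t - s) : ℝ) : ℂ) + m * I) := by
    rw [normSq_eq_norm_sq, normSq_eq_norm_sq, hn]
  rw [normSq_add_mul_I, normSq_add_mul_I] at hq
  have hx : t - s = -2 * x := by
    apply mul_left_cancel₀ hts
    linarith
  refine ⟨x, m, ?_, by linear_combination hz', ?_, ?_⟩
  · rintro rfl
    exact hts (by linarith)
  · rw [hx] at hY'
    push_cast at hY'
    linear_combination hY'
  · have hB : B - O = ((x - s : ℝ) + m * I) * (C - B) := by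
      push_cast
      linear_combination hz' - hs
    rw [hB, mul_assoc, mul_conj]
    simp

/-- Two lines through `O + (±x + m i) a` with directions `Z a` and `conj Z a` meet on the
perpendicular through `O` to `a`. -/
lemma Complex.exists_apex_eq {O a P Q T Z : ℂ} {x m : ℝ} (ha : a ≠ 0) (hx : x ≠ 0)
    (hZ : Z.im ≠ 0)
    (hP : ((O + (x + m * I) * a - P) * conj a * conj Z).im = 0)
    (hQ : ((O + (-x + m * I) * a - Q) * conj a * conj (-conj Z)).im = 0)
    (hTP : T ∈ line[ℝ, P, O + (x + m * I) * a]) (hTQ : T ∈ line[ℝ, Q, O + (-x + m * I) * a]) :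
    Z.re ≠ 0 ∧ T = O + ((m - x * Z.im / Z.re : ℝ) * I) * a := by
  have hZ0 : Z ≠ 0 := by
    rintro rfl
    exact hZ rfl
  obtain ⟨p, hp⟩ := exists_eq_smul_sub_of_mem_line hTP
  obtain ⟨q, hq⟩ := exists_eq_smul_sub_of_mem_line hTQ
  obtain ⟨u, hu⟩ := exists_eq_smul_of_im_mul_conj_eq_zero (mul_ne_zero hZ0 ha)
    (z := O + (x + m * I) * a - P) (by rwa [map_mul, mul_comm (conj Z), ← mul_assoc])
  obtain ⟨v, hv⟩ := exists_eq_smul_of_im_mul_conj_eq_zero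
    (mul_ne_zero (neg_ne_zero.mpr ((map_ne_zero _).mpr hZ0)) ha)
    (z := O + (-x + m * I) * a - Q) (by rwa [map_mul, mul_comm (conj (-conj Z)), ← mul_assoc])
  rw [real_smul] at hu hv
  rw [hu] at hp
  rw [hv] at hq
  have h1 : T = O + (x + m * I + ((p - 1) * u : ℝ) * Z) * a := by
    push_cast
    linear_combination hp - hu
  have h2 : T = O + (-x + m * I - ((q - 1) * v : ℝ) * conj Z) * a := by
    push_cast
    linear_combination hq - hv
  have h3 : (x : ℂ) + m * I + ((p - 1) * u : ℝ) * Z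
      = -x + m * I - ((q - 1) * v : ℝ) * conj Z := by
    apply mul_right_cancel₀ ha
    linear_combination h2 - h1
  generalize (p - 1) * u = ρ at h1 h3
  generalize (q - 1) * v = σ at h3
  have hre := congrArg re h3
  have him := congrArg im h3
  simp at hre him
  have hσ : σ = ρ := by
    rcases him with h | h
    exacts [h.symm, absurd h hZ]
  subst hσ
  have hx' : x = -(σ * Z.re) := by linarith
  have hre0 : Z.re ≠ 0 := by
    intro h
    rw [h] at hx'
    exact hx (by simpa using hx')
  refine ⟨hre0, ?_⟩
  rw [h1]
  congr 2
  apply Complex.ext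
  · simp [hx']
  · simp only [hx']
    simp
    field_simp
    ring

lemma Complex.exists_chord_eq_smul {A B C l : ℂ} {r : ℝ} (hr : r ≠ 0) (hl : l ≠ 0)
    (hBC : C - B ≠ 0) (hA : A * conj A = (r : ℂ) ^ 2) (hB : B * conj B = (r : ℂ) ^ 2)
    (hC : C * conj C = (r : ℂ) ^ 2) :
    ∃ t : ℝ, l / conj l * (conj (A * B * C) / (r : ℂ) ^ 2) - A = t • (l * conj (C - B)) := by
  have hrc : (r : ℂ) ≠ 0 := by exact_mod_cast hr
  have hr2 : (r : ℂ) ^ 2 ≠ 0 := pow_ne_zero 2 hrc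
  have hl' : conj l ≠ 0 := (map_ne_zero _).mpr hl
  apply exists_eq_smul_of_im_mul_conj_eq_zero
    (mul_ne_zero hl ((map_ne_zero _).mpr hBC))
  apply im_eq_zero_of_conj_eq
  simp only [map_sub, map_mul, map_div₀, map_pow, conj_conj, conj_ofReal]
  have hA0 : A ≠ 0 := left_ne_zero_of_mul (hA ▸ hr2)
  have hB0 : B ≠ 0 := left_ne_zero_of_mul (hB ▸ hr2)
  have hC0 : C ≠ 0 := left_ne_zero_of_mul (hC ▸ hr2)
  rw [eq_div_of_mul_eq hA0 ((mul_comm _ _).trans hA),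
    eq_div_of_mul_eq hB0 ((mul_comm _ _).trans hB),
    eq_div_of_mul_eq hC0 ((mul_comm _ _).trans hC)]
  field_simp
  ring

lemma Complex.im_sum_mul_conj_ne_zero {A B C O : ℂ} (h : AffineIndependent ℝ ![A, B, C]) :
    ((B - O) * conj (C - B)).im + ((C - O) * conj (A - C)).im
      + ((A - O) * conj (B - A)).im ≠ 0 := by
  intro h0
  rw [affineIndependent_iff_not_collinear_set] at h
  by_cases hAB : B - A = 0
  · rw [sub_eq_zero.mp hAB] at h
    exact h (by simpa using collinear_pair ℝ A C)
  apply h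
  obtain ⟨t, ht⟩ := exists_eq_smul_of_im_mul_conj_eq_zero (z := C - A) hAB (by
    simp at h0 ⊢
    linarith)
  rw [collinear_iff_of_mem (p₀ := A) (by simp)]
  refine ⟨B - A, ?_⟩
  simp only [Set.mem_insert_iff, Set.mem_singleton_iff, forall_eq_or_imp, forall_eq]
  exact ⟨⟨0, by simp⟩, ⟨1, by simp⟩, ⟨t, by rw [← ht]; simp⟩⟩

/-- Points on the perpendiculars from `O` to the sides form a triangle inversely similar to the
triangle with side vectors `a`, `b`, `c` as soon as the weighted sum of their offsets vanishes. -/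
lemma Complex.offset_sub_mul_conj_eq {a b c : ℂ} {u v w : ℝ} (habc : a + b + c = 0)
    (h : u * normSq a + v * normSq b + w * normSq c = 0) :
    (w * I * c - v * I * b) * conj b = (u * I * a - w * I * c) * conj a := by
  have h' : (u : ℂ) * (a * conj a) + v * (b * conj b) + w * (c * conj c) = 0 := by
    simp only [mul_conj]
    exact_mod_cast h
  have hc : conj a + conj b + conj c = 0 := by
    rw [← map_add, ← map_add, habc, map_zero]
  linear_combination (-I) * h' + w * I * c * hc

/- STATEMENT 11 (Generalized Steiner point): The line through A parallel to T_BT_C,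
the line through B parallel to T_CT_A and the line through C parallel to T_AT_B are
concurrent at a point S_t on the circumcircle of ABC.  The plane is modelled by ℂ. -/

theorem generalized_steiner_point
    (A B C O : ℂ)
    -- triangle ABC is nondegenerate
    (hABC : AffineIndependent ℝ ![A, B, C])
    -- Γ is a circle with center O meeting the sidelines in the six points
    (Γ : EuclideanGeometry.Sphere ℂ) (hO : Γ.center = O)
    (A₁ A₂ B₁ B₂ C₁ C₂ : ℂ)
    (hA₁Γ : A₁ ∈ Γ) (hA₂Γ : A₂ ∈ Γ) (hB₁Γ : B₁ ∈ Γ)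
    (hB₂Γ : B₂ ∈ Γ) (hC₁Γ : C₁ ∈ Γ) (hC₂Γ : C₂ ∈ Γ)
    (hA₁ : A₁ ∈ line[ℝ, B, C]) (hA₂ : A₂ ∈ line[ℝ, B, C])
    (hB₁ : B₁ ∈ line[ℝ, C, A]) (hB₂ : B₂ ∈ line[ℝ, C, A])
    (hC₁ : C₁ ∈ line[ℝ, A, B]) (hC₂ : C₂ ∈ line[ℝ, A, B])
    -- the six points are distinct from each other and from the vertices
    (hdist : List.Pairwise (· ≠ ·) [A, B, C, A₁, A₂, B₁, B₂, C₁, C₂])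
    -- P is the Miquel point of A₁B₁C₁ in ABC, Q that of A₂B₂C₂
    (P Q : ℂ)
    (hP₁ : Cospherical ({A, B₁, C₁, P} : Set ℂ))
    (hP₂ : Cospherical ({B, C₁, A₁, P} : Set ℂ))
    (hP₃ : Cospherical ({C, A₁, B₁, P} : Set ℂ))
    (hQ₁ : Cospherical ({A, B₂, C₂, Q} : Set ℂ))
    (hQ₂ : Cospherical ({B, C₂, A₂, Q} : Set ℂ))
    (hQ₃ : Cospherical ({C, A₂, B₂, Q} : Set ℂ))
    -- T_A = PA₁ ∩ QA₂, T_B = PB₁ ∩ QB₂, T_C = PC₁ ∩ QC₂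
    (T_A T_B T_C : ℂ)
    (hTA₁ : T_A ∈ line[ℝ, P, A₁]) (hTA₂ : T_A ∈ line[ℝ, Q, A₂])
    (hTB₁ : T_B ∈ line[ℝ, P, B₁]) (hTB₂ : T_B ∈ line[ℝ, Q, B₂])
    (hTC₁ : T_C ∈ line[ℝ, P, C₁]) (hTC₂ : T_C ∈ line[ℝ, Q, C₂])
    (hT : ¬ Collinear ℝ ({T_A, T_B, T_C} : Set ℂ))
    -- ω is the circumcircle of triangle ABC
    (ω : EuclideanGeometry.Sphere ℂ)
    (hAω : A ∈ ω) (hBω : B ∈ ω) (hCω : C ∈ ω)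
    :
    -- conclusion: the three parallels meet at a point of the circumcircle
    ∃ S_t : ℂ, S_t ∈ ω ∧
      (∃ t : ℝ, S_t - A = t • (T_C - T_B)) ∧
      (∃ t : ℝ, S_t - B = t • (T_A - T_C)) ∧
      (∃ t : ℝ, S_t - C = t • (T_B - T_A)) := by
  subst hO
  simp only [List.pairwise_cons, List.mem_cons, List.not_mem_nil, or_false, forall_eq_or_imp,
    forall_eq, false_imp_iff, implies_true, List.Pairwise.nil, and_true] at hdist
  obtain ⟨⟨hAB, hAC, -, -, hAB₁, hAB₂, hAC₁, hAC₂⟩, ⟨hBC, hBA₁, hBA₂, -, -, hBC₁, hBC₂⟩,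
    ⟨hCA₁, hCA₂, hCB₁, hCB₂, -, -⟩, ⟨hAA, -⟩, -, ⟨hBB, -⟩, -, hCC⟩ := hdist
  have ha : C - B ≠ 0 := sub_ne_zero.mpr hBC.symm
  have hb : A - C ≠ 0 := sub_ne_zero.mpr hAC
  have hc : B - A ≠ 0 := sub_ne_zero.mpr hAB.symm
  obtain ⟨x, m, hx, hA₁e, hA₂e, hm⟩ :=
    Complex.exists_eq_center_add_of_mem_line ha hA₁Γ hA₂Γ hAA hA₁ hA₂
  obtain ⟨y, n, hy, hB₁e, hB₂e, hn⟩ :=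
    Complex.exists_eq_center_add_of_mem_line hb hB₁Γ hB₂Γ hBB hB₁ hB₂
  obtain ⟨z, k, hz, hC₁e, hC₂e, hk⟩ :=
    Complex.exists_eq_center_add_of_mem_line hc hC₁Γ hC₂Γ hCC hC₁ hC₂
  obtain ⟨Z, hZ⟩ : ∃ Z : ℂ, Z = (x + m * Complex.I) * Complex.normSq (C - B)
      + (y + n * Complex.I) * Complex.normSq (A - C)
      + (z + k * Complex.I) * Complex.normSq (B - A) := ⟨_, rfl⟩
  have hZre : Z.re = x * Complex.normSq (C - B) + y * Complex.normSq (A - C)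
      + z * Complex.normSq (B - A) := by
    rw [hZ]
    simp
  have hZim : Z.im = m * Complex.normSq (C - B) + n * Complex.normSq (A - C)
      + k * Complex.normSq (B - A) := by
    rw [hZ]
    simp
  have hZ0 : Z.im ≠ 0 := by
    rw [hZim, hm, hn, hk]
    exact Complex.im_sum_mul_conj_ne_zero hABC
  have hsum₁ : (A₁ - P) * conj (C - B) + (B₁ - P) * conj (A - C) + (C₁ - P) * conj (B - A)
      = Z := by
    rw [hZ, hA₁e, hB₁e, hC₁e]
    simp only [Complex.normSq_eq_conj_mul_self, map_sub]
    ring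
  have hsum₂ : (A₂ - Q) * conj (C - B) + (B₂ - Q) * conj (A - C) + (C₂ - Q) * conj (B - A)
      = -conj Z := by
    rw [hZ, hA₂e, hB₂e, hC₂e]
    simp only [Complex.normSq_eq_conj_mul_self, map_sub, map_add, map_mul, Complex.conj_ofReal,
      Complex.conj_I, Complex.conj_conj]
    ring
  have hPA := Complex.im_miquel_eq_zero hP₂ hP₃ hA₁ hB₁ hC₁ hBA₁.symm hCA₁.symm hCB₁.symm
    hBC₁.symm hsum₁
  have hPB := Complex.im_miquel_eq_zero (Z := Z) hP₃ hP₁ hB₁ hC₁ hA₁ hCB₁.symm hAB₁.symm hAC₁.symm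
    hCA₁.symm (by rw [← hsum₁]; ring)
  have hPC := Complex.im_miquel_eq_zero (Z := Z) hP₁ hP₂ hC₁ hA₁ hB₁ hAC₁.symm hBC₁.symm hBA₁.symm
    hAB₁.symm (by rw [← hsum₁]; ring)
  have hQA := Complex.im_miquel_eq_zero hQ₂ hQ₃ hA₂ hB₂ hC₂ hBA₂.symm hCA₂.symm hCB₂.symm
    hBC₂.symm hsum₂
  have hQB := Complex.im_miquel_eq_zero (Z := -conj Z) hQ₃ hQ₁ hB₂ hC₂ hA₂ hCB₂.symm hAB₂.symm hAC₂.symm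
    hCA₂.symm (by rw [← hsum₂]; ring)
  have hQC := Complex.im_miquel_eq_zero (Z := -conj Z) hQ₁ hQ₂ hC₂ hA₂ hB₂ hAC₂.symm hBC₂.symm hBA₂.symm
    hAB₂.symm (by rw [← hsum₂]; ring)
  rw [hA₁e] at hPA hTA₁
  rw [hB₁e] at hPB hTB₁
  rw [hC₁e] at hPC hTC₁
  rw [hA₂e] at hQA hTA₂
  rw [hB₂e] at hQB hTB₂
  rw [hC₂e] at hQC hTC₂
  obtain ⟨hre, hTA⟩ := Complex.exists_apex_eq ha hx hZ0 hPA hQA hTA₁ hTA₂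
  obtain ⟨-, hTB⟩ := Complex.exists_apex_eq hb hy hZ0 hPB hQB hTB₁ hTB₂
  obtain ⟨-, hTC⟩ := Complex.exists_apex_eq hc hz hZ0 hPC hQC hTC₁ hTC₂
  have hsim : (T_C - T_B) * conj (A - C) = (T_A - T_C) * conj (C - B) := by
    have h := Complex.offset_sub_mul_conj_eq (a := C - B) (b := A - C) (c := B - A)
      (u := m - x * Z.im / Z.re) (v := n - y * Z.im / Z.re) (w := k - z * Z.im / Z.re) (by ring)
      (by
        field_simp
        linear_combination Z.im * hZre - Z.re * hZim)
    rw [hTA, hTB, hTC]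
    linear_combination h
  have ha' : conj (C - B) ≠ 0 := (map_ne_zero _).mpr ha
  obtain ⟨l, hl⟩ : ∃ l, l = (T_C - T_B) / conj (C - B) := ⟨_, rfl⟩
  have hla : T_C - T_B = l * conj (C - B) := by
    rw [hl, div_mul_cancel₀ _ ha']
  have hlb : T_A - T_C = l * conj (A - C) := by
    apply mul_right_cancel₀ ha'
    rw [← hsim, hla]
    ring
  have hlc : T_B - T_A = l * conj (B - A) := by
    have h : conj (B - A) = -conj (C - B) - conj (A - C) := by
      simp only [map_sub]
      ring
    rw [h]
    linear_combination -hla - hlb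
  have hl0 : l ≠ 0 := by
    rintro rfl
    rw [zero_mul] at hla hlb
    rw [← sub_eq_zero.mp hla, sub_eq_zero.mp hlb] at hT
    exact hT (by simpa using collinear_singleton ℝ T_C)
  have hA := Complex.mul_conj_sub_eq_of_dist_eq hAω
  have hB := Complex.mul_conj_sub_eq_of_dist_eq hBω
  have hC := Complex.mul_conj_sub_eq_of_dist_eq hCω
  have hr : ω.radius ≠ 0 := by
    intro h
    have h1 : dist A ω.center = ω.radius := hAω
    have h2 : dist B ω.center = ω.radius := hBω
    rw [h, dist_eq_zero] at h1 h2
    exact hAB (h1.trans h2.symm)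
  rw [hla, hlb, hlc]
  refine ⟨ω.center + l / conj l * (conj ((A - ω.center) * (B - ω.center) * (C - ω.center))
    / (ω.radius : ℂ) ^ 2), ?_, ?_, ?_, ?_⟩
  · have h1 : ‖A - ω.center‖ = ω.radius := by rw [← dist_eq_norm]; exact hAω
    have h2 : ‖B - ω.center‖ = ω.radius := by rw [← dist_eq_norm]; exact hBω
    have h3 : ‖C - ω.center‖ = ω.radius := by rw [← dist_eq_norm]; exact hCω
    have hl1 : ‖l‖ ≠ 0 := norm_ne_zero_iff.mpr hl0
    rw [mem_sphere, dist_eq_norm, add_sub_cancel_left, norm_mul, norm_div, norm_div,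
      Complex.norm_conj, Complex.norm_conj, norm_mul, norm_mul, h1, h2, h3, norm_pow,
      Complex.norm_real, Real.norm_eq_abs, sq_abs, div_self hl1]
    field_simp
  · obtain ⟨t, ht⟩ := Complex.exists_chord_eq_smul hr hl0 (B := B - ω.center)
      (C := C - ω.center) (by simpa using ha) hA hB hC
    refine ⟨t, ?_⟩
    rw [sub_sub_sub_cancel_right] at ht
    rw [← ht]
    ring
  · obtain ⟨t, ht⟩ := Complex.exists_chord_eq_smul hr hl0 (B := C - ω.center)
      (C := A - ω.center) (by simpa using hb) hB hC hA
    refine ⟨t, ?_⟩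
    rw [sub_sub_sub_cancel_right] at ht
    rw [← ht]
    simp only [map_mul]
    ring
  · obtain ⟨t, ht⟩ := Complex.exists_chord_eq_smul hr hl0 (B := A - ω.center)
      (C := B - ω.center) (by simpa using hc) hC hA hB
    refine ⟨t, ?_⟩
    rw [sub_sub_sub_cancel_right] at ht
    rw [← ht]
    simp only [map_mul]
    ring
end
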